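/- arXiv:math/0310259 — 5 statements merged into one kernel-verified Lean document; each statement's English description precedes it below -/
import Mathlib

section
/- For all integers k and n with 2 ≤ k ≤ n, one has ∑_{d=k−1}^{n−1} C(d−1, k−2) · S(n,d) = C(n−1, k−1) · ζ(n), where C(a,b) denotes the binomial coefficient. -/
open scoped BigOperators

/-- The Riemann zeta value `ζ(n) = ∑_{k ≥ 1} 1/k^n` (as a real series). -/
noncomputable def riemannZetaReal (n : ℕ) : ℝ :=
  ∑' k : ℕ, 1 / ((k : ℝ) + 1) ^ n

/-- The multiple zeta value `ζ(k₁, …, k_r) = ∑_{n₁ > ⋯ > n_r > 0} 1/(n₁^{k₁} ⋯ n_r^{k_r})`. -/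
noncomputable def multipleZeta {r : ℕ} (k : Fin r → ℕ) : ℝ :=
  ∑' n : {n : Fin r → ℕ // StrictAnti n ∧ ∀ i, 0 < n i},
    1 / ∏ i, ((n.1 i : ℝ)) ^ (k i)

/-- `S(n, r)`: the sum of all multiple zeta values of weight `n` and depth `r`. -/
noncomputable def zetaSum (n r : ℕ) : ℝ :=
  ∑' k : {k : Fin r → ℕ //
      (∀ i, 1 ≤ k i) ∧ (∀ h : 0 < r, 2 ≤ k ⟨0, h⟩) ∧ (∑ i, k i) = n},
    multipleZeta k.1

open Filter Topology

/-! ### Power series with nonnegative extended real coefficients -/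

theorem tsum_mul_pow_eq_zero_add (c : ℕ → ENNReal) (y : ENNReal) :
    ∑' j, c j * y ^ j = c 0 + y * ∑' j, c (j + 1) * y ^ j := by
  rw [tsum_eq_zero_add' ENNReal.summable, ← ENNReal.tsum_mul_left]
  simp only [pow_zero, mul_one]
  congr 1
  refine tsum_congr fun j => ?_
  ring

theorem le_of_forall_tsum_mul_pow_eq {a b : ℕ → ENNReal}
    (h : ∀ x : ℝ, 0 < x → x < 1 →
      ∑' j, a j * ENNReal.ofReal x ^ j = ∑' j, b j * ENNReal.ofReal x ^ j)
    (hb : ∑' j, b (j + 1) * ENNReal.ofReal (1 / 2) ^ j ≠ ⊤) : a 0 ≤ b 0 := by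
  set M := ∑' j, b (j + 1) * ENNReal.ofReal (1 / 2) ^ j with hM
  have hle : ∀ x : ℝ, 0 < x → x < 1 / 2 → a 0 ≤ b 0 + ENNReal.ofReal x * M := by
    intro x hx0 hx
    calc a 0 ≤ ∑' j, a j * ENNReal.ofReal x ^ j := by
          simpa using ENNReal.le_tsum (f := fun j => a j * ENNReal.ofReal x ^ j) 0
      _ = ∑' j, b j * ENNReal.ofReal x ^ j := h x hx0 (by linarith)
      _ = b 0 + ENNReal.ofReal x * ∑' j, b (j + 1) * ENNReal.ofReal x ^ j :=
          tsum_mul_pow_eq_zero_add b _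
      _ ≤ b 0 + ENNReal.ofReal x * M := by
          gcongr
          rw [hM]
          gcongr
  have hlim : Tendsto (fun x : ℝ => b 0 + ENNReal.ofReal x * M) (𝓝[>] 0) (𝓝 (b 0)) := by
    have h1 : Tendsto (fun x : ℝ => ENNReal.ofReal x * M) (𝓝[>] 0) (𝓝 0) := by
      have h2 : Tendsto (fun x : ℝ => ENNReal.ofReal x) (𝓝[>] 0) (𝓝 0) := by
        simpa using (ENNReal.continuous_ofReal.tendsto 0).mono_left nhdsWithin_le_nhds
      simpa using ENNReal.Tendsto.mul_const h2 (Or.inr hb)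
    simpa using h1.const_add (b 0)
  refine ge_of_tendsto hlim ?_
  filter_upwards [Ioo_mem_nhdsGT (show (0 : ℝ) < 1 / 2 by norm_num)] with x hx
  exact hle x hx.1 hx.2

theorem tsum_succ_mul_half_pow_ne_top {a : ℕ → ENNReal}
    (ha : ∑' j, a j * ENNReal.ofReal (1 / 2) ^ j ≠ ⊤) :
    ∑' j, a (j + 1) * ENNReal.ofReal (1 / 2) ^ j ≠ ⊤ := by
  rw [tsum_mul_pow_eq_zero_add] at ha
  intro h
  rw [h, ENNReal.mul_top (by simp), add_top] at ha
  exact ha rfl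

theorem coeff_eq_of_forall_tsum_mul_pow_eq (i : ℕ) : ∀ {a b : ℕ → ENNReal},
    (∀ x : ℝ, 0 < x → x < 1 →
      ∑' j, a j * ENNReal.ofReal x ^ j = ∑' j, b j * ENNReal.ofReal x ^ j) →
    (∀ x : ℝ, 0 < x → x < 1 → ∑' j, b j * ENNReal.ofReal x ^ j ≠ ⊤) → a i = b i := by
  have zeroth : ∀ {a b : ℕ → ENNReal},
      (∀ x : ℝ, 0 < x → x < 1 →
        ∑' j, a j * ENNReal.ofReal x ^ j = ∑' j, b j * ENNReal.ofReal x ^ j) →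
      (∀ x : ℝ, 0 < x → x < 1 → ∑' j, b j * ENNReal.ofReal x ^ j ≠ ⊤) → a 0 = b 0 := by
    intro a b h hb
    have hhalf := hb (1 / 2) (by norm_num) (by norm_num)
    refine le_antisymm (le_of_forall_tsum_mul_pow_eq h (tsum_succ_mul_half_pow_ne_top hhalf))
      (le_of_forall_tsum_mul_pow_eq (fun x h0 h1 => (h x h0 h1).symm)
        (tsum_succ_mul_half_pow_ne_top ?_))
    rwa [h (1 / 2) (by norm_num) (by norm_num)]
  induction i with
  | zero => exact zeroth
  | succ i ih =>
    intro a b h hb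
    have h0 := zeroth h hb
    refine ih (a := fun j => a (j + 1)) (b := fun j => b (j + 1)) ?_ ?_
    · intro x hx0 hx1
      have h1 := h x hx0 hx1
      have h2 := hb x hx0 hx1
      rw [tsum_mul_pow_eq_zero_add b] at h2
      rw [tsum_mul_pow_eq_zero_add a, tsum_mul_pow_eq_zero_add b, h0] at h1
      have h3 := (ENNReal.add_right_inj (ENNReal.add_ne_top.mp h2).1).mp h1
      exact (ENNReal.mul_right_inj (by simpa using hx0) ENNReal.ofReal_ne_top).mp h3
    · intro x hx0 hx1 htop
      apply hb x hx0 hx1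
      rw [tsum_mul_pow_eq_zero_add b, htop, ENNReal.mul_top (by simpa using hx0), add_top]

/-! ### The connector -/

/-- The connector `∏_{i ≤ m} (i - x) ∏_{j ≤ b} (j - x) / ∏_{i ≤ m + b} (i - x)`. -/
noncomputable def connector (x : ℝ) (m b : ℕ) : ℝ :=
  (∏ i ∈ Finset.range m, ((i : ℝ) + 1 - x)) * (∏ i ∈ Finset.range b, ((i : ℝ) + 1 - x)) /
    ∏ i ∈ Finset.range (m + b), ((i : ℝ) + 1 - x)

theorem natCast_add_one_sub_pos {x : ℝ} (hx : x < 1) (i : ℕ) : 0 < (i : ℝ) + 1 - x := by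
  have : (0 : ℝ) ≤ i := i.cast_nonneg
  linarith

theorem prod_natCast_add_one_sub_pos {x : ℝ} (hx : x < 1) (m : ℕ) :
    0 < ∏ i ∈ Finset.range m, ((i : ℝ) + 1 - x) :=
  Finset.prod_pos fun i _ => natCast_add_one_sub_pos hx i

theorem connector_pos {x : ℝ} (hx : x < 1) (m b : ℕ) : 0 < connector x m b :=
  div_pos (mul_pos (prod_natCast_add_one_sub_pos hx m) (prod_natCast_add_one_sub_pos hx b))
    (prod_natCast_add_one_sub_pos hx (m + b))

theorem connector_comm (x : ℝ) (m b : ℕ) : connector x m b = connector x b m := by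
  rw [connector, connector, add_comm m b, mul_comm (∏ i ∈ Finset.range m, _)]

theorem connector_zero_left {x : ℝ} (hx : x < 1) (b : ℕ) : connector x 0 b = 1 := by
  simp [connector, (prod_natCast_add_one_sub_pos hx b).ne']

theorem connector_succ_left {x : ℝ} (hx : x < 1) (m b : ℕ) :
    connector x (m + 1) b * ((m : ℝ) + b + 1 - x) = connector x m b * ((m : ℝ) + 1 - x) := by
  have h1 := (prod_natCast_add_one_sub_pos hx (m + b)).ne'
  have h2 := (natCast_add_one_sub_pos hx (m + b)).ne'
  push_cast at h2
  rw [connector, connector, show m + 1 + b = m + b + 1 by ring, Finset.prod_range_succ,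
    Finset.prod_range_succ _ (m + b)]
  push_cast
  field_simp

theorem connector_sub_connector_succ {x : ℝ} (hx : x < 1) (m b : ℕ) :
    connector x (m + 1) b * (1 / (((m + 1 : ℕ) : ℝ) - x)) * b
      = connector x m b - connector x (m + 1) b := by
  have h1 := connector_succ_left hx m b
  have h2 := (natCast_add_one_sub_pos hx m).ne'
  push_cast
  field_simp
  linear_combination h1

theorem connector_succ_right_le {x : ℝ} (hx : x < 1) (m b : ℕ) :
    connector x m (b + 1) ≤ connector x m b := by
  have h1 := connector_succ_left hx b m
  rw [connector_comm x (b + 1), connector_comm x b] at h1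
  have h2 := natCast_add_one_sub_pos hx b
  have h3 := connector_pos hx m (b + 1)
  have h4 : (0 : ℝ) ≤ m := m.cast_nonneg
  nlinarith [mul_nonneg h3.le h4]

theorem connector_succ_le {x : ℝ} (hx : x < 1) (m b : ℕ) :
    connector x m (b + 1) ≤ (1 - x) / ((m : ℝ) + 1 - x) := by
  induction b with
  | zero =>
    have h1 := connector_succ_left hx 0 m
    rw [connector_comm x (0 + 1), connector_zero_left hx] at h1
    rw [le_div_iff₀ (natCast_add_one_sub_pos hx m)]
    push_cast at h1
    linarith
  | succ b ih => exact (connector_succ_right_le hx m (b + 1)).trans ih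

theorem tendsto_connector {x : ℝ} (hx : x < 1) (b : ℕ) :
    Tendsto (fun m => connector x m (b + 1)) atTop (𝓝 0) := by
  refine squeeze_zero (fun m => (connector_pos hx m _).le) (fun m => connector_succ_le hx m b) ?_
  refine Tendsto.div_atTop tendsto_const_nhds ?_
  simp only [add_sub_assoc]
  exact tendsto_atTop_add_const_right _ _ tendsto_natCast_atTop_atTop

theorem hasSum_connector {x : ℝ} (hx : x < 1) (m b : ℕ) :
    HasSum (fun j : ℕ => connector x (m + 1 + j) (b + 1) * (1 / (((m + 1 + j : ℕ) : ℝ) - x)))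
      (connector x m (b + 1) * (1 / ((b : ℝ) + 1))) := by
  have hb : (b : ℝ) + 1 ≠ 0 := by positivity
  have key : ∀ j : ℕ, connector x (m + 1 + j) (b + 1) * (1 / (((m + 1 + j : ℕ) : ℝ) - x))
      = (connector x (m + j) (b + 1) - connector x (m + (j + 1)) (b + 1)) * (1 / ((b : ℝ) + 1)) := by
    intro j
    have h := connector_sub_connector_succ hx (m + j) (b + 1)
    rw [show m + 1 + j = m + j + 1 by ring, ← add_assoc, ← h]
    push_cast
    rw [mul_assoc _ ((b : ℝ) + 1), mul_one_div_cancel hb, mul_one]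
  rw [hasSum_iff_tendsto_nat_of_nonneg]
  · simp only [key, ← Finset.sum_mul]
    refine Tendsto.mul_const _ ?_
    have hs : ∀ N, ∑ j ∈ Finset.range N,
        (connector x (m + j) (b + 1) - connector x (m + (j + 1)) (b + 1))
          = connector x m (b + 1) - connector x (m + N) (b + 1) :=
      fun N => Finset.sum_range_sub' (fun j => connector x (m + j) (b + 1)) N
    simp only [hs]
    have ht : Tendsto (fun N => connector x (m + N) (b + 1)) atTop (𝓝 0) := by
      simpa only [add_comm m] using (tendsto_add_atTop_iff_nat m).mpr (tendsto_connector hx b)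
    simpa using tendsto_const_nhds.sub ht
  · intro j
    have := natCast_add_one_sub_pos hx (m + j)
    refine mul_nonneg (connector_pos hx _ _).le (one_div_nonneg.mpr ?_)
    push_cast at this ⊢
    linarith

/-- The weight `1 / (m - x)` as an extended nonnegative real. -/
noncomputable def shiftedInv (x : ℝ) (m : ℕ) : ENNReal :=
  ENNReal.ofReal (1 / ((m : ℝ) - x))

theorem tsum_ofReal_connector {x : ℝ} (hx : x < 1) (m b : ℕ) :
    ∑' j : ℕ, ENNReal.ofReal (connector x (m + 1 + j) (b + 1)) * shiftedInv x (m + 1 + j)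
      = ENNReal.ofReal (connector x m (b + 1)) * ENNReal.ofReal (1 / ((b : ℝ) + 1)) := by
  have h := hasSum_connector hx m b
  simp only [shiftedInv, ← ENNReal.ofReal_mul (connector_pos hx _ _).le]
  rw [← h.tsum_eq, ENNReal.ofReal_tsum_of_nonneg _ h.summable]
  intro j
  have := natCast_add_one_sub_pos hx (m + j)
  refine mul_nonneg (connector_pos hx _ _).le (one_div_nonneg.mpr ?_)
  push_cast at this ⊢
  linarith

theorem tsum_connector_shiftedInv {x : ℝ} (hx : x < 1) (m : ℕ) :
    ∑' b : ℕ, ENNReal.ofReal (connector x (m + 1) (b + 1)) * shiftedInv x (b + 1)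
      = ENNReal.ofReal (1 / ((m : ℝ) + 1)) := by
  have h := tsum_ofReal_connector hx 0 m
  rw [connector_zero_left hx, ENNReal.ofReal_one, one_mul] at h
  rw [← h]
  refine tsum_congr fun b => ?_
  rw [connector_comm, show 0 + 1 + b = b + 1 by ring]

/-! ### Sums over decreasing tuples -/

/-- Strictly decreasing tuples of positive integers. -/
abbrev DecTuple (r : ℕ) : Type :=
  {n : Fin r → ℕ // StrictAnti n ∧ ∀ i, 0 < n i}

/-- The largest entry of a decreasing tuple, and `0` for the empty tuple. -/
def DecTuple.head : {r : ℕ} → DecTuple r → ℕ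
  | 0, _ => 0
  | _ + 1, n => n.1 0

theorem DecTuple.head_lt_iff {r : ℕ} (n : DecTuple r) (m : ℕ) :
    n.head < m ↔ 0 < m ∧ ∀ i, n.1 i < m := by
  cases r with
  | zero => simp [DecTuple.head]
  | succ r =>
    refine ⟨fun h => ⟨(Nat.zero_le _).trans_lt h, fun i => ?_⟩, fun h => h.2 0⟩
    exact (n.2.1.antitone (Fin.zero_le i)).trans_lt h

theorem strictAnti_cons_iff {r : ℕ} (m : ℕ) (n : Fin r → ℕ) :
    StrictAnti (Fin.cons m n : Fin (r + 1) → ℕ) ↔ (∀ i, n i < m) ∧ StrictAnti n := by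
  constructor
  · intro h
    refine ⟨fun i => ?_, fun i j hij => ?_⟩
    · simpa using h (Fin.succ_pos i)
    · simpa using h (Fin.succ_lt_succ_iff.mpr hij)
  · rintro ⟨h1, h2⟩ i j hij
    induction j using Fin.cases with
    | zero => exact absurd hij (Fin.not_lt_zero i)
    | succ j =>
      induction i using Fin.cases with
      | zero => simpa using h1 j
      | succ i => simpa using h2 (Fin.succ_lt_succ_iff.mp hij)

/-- A decreasing tuple is determined by its tail and the gap between its first two entries. -/
def DecTuple.consEquiv (r : ℕ) : DecTuple r × ℕ ≃ DecTuple (r + 1) where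
  toFun p := ⟨Fin.cons (p.1.head + 1 + p.2) p.1.1, by
    have h := (p.1.head_lt_iff (p.1.head + 1 + p.2)).mp (by omega)
    exact ⟨(strictAnti_cons_iff _ _).mpr ⟨h.2, p.1.2.1⟩, Fin.cases h.1 p.1.2.2⟩⟩
  invFun n :=
    let t : DecTuple r := ⟨Fin.tail n.1, by
      have h := n.2.1
      rw [← Fin.cons_self_tail n.1, strictAnti_cons_iff] at h
      exact ⟨h.2, fun i => n.2.2 i.succ⟩⟩
    (t, n.1 0 - t.head - 1)
  left_inv p := by
    ext <;> simp
    omega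
  right_inv n := by
    have h := n.2.1
    rw [← Fin.cons_self_tail n.1, strictAnti_cons_iff] at h
    let t : DecTuple r := ⟨Fin.tail n.1, h.2, fun i => n.2.2 i.succ⟩
    have ht : t.head < n.1 0 := (t.head_lt_iff _).mpr ⟨n.2.2 0, h.1⟩
    apply Subtype.ext
    change Fin.cons (t.head + 1 + (n.1 0 - t.head - 1)) (Fin.tail n.1) = n.1
    rw [show t.head + 1 + (n.1 0 - t.head - 1) = n.1 0 by omega, Fin.cons_self_tail]

theorem DecTuple.tsum_head_mul_prod {c w : ℕ → ENNReal} {q : ENNReal}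
    (h : ∀ m, ∑' j : ℕ, c (m + 1 + j) * w (m + 1 + j) = c m * q) (r : ℕ) :
    ∑' n : DecTuple r, c n.head * ∏ i, w (n.1 i) = c 0 * q ^ r := by
  induction r with
  | zero =>
    have : Unique (DecTuple 0) :=
      ⟨⟨⟨Fin.elim0, fun i => i.elim0, fun i => i.elim0⟩⟩,
        fun n => Subtype.ext (Subsingleton.elim _ _)⟩
    rw [tsum_fintype]
    simp [DecTuple.head]
  | succ r ih =>
    rw [← (DecTuple.consEquiv r).tsum_eq, ENNReal.tsum_prod']
    have step : ∀ n : DecTuple r, ∑' j : ℕ, c (DecTuple.consEquiv r (n, j)).head *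
        ∏ i, w ((DecTuple.consEquiv r (n, j)).1 i) = q * (c n.head * ∏ i, w (n.1 i)) := by
      intro n
      rw [← mul_assoc, mul_comm q, ← h, ← ENNReal.tsum_mul_right]
      refine tsum_congr fun j => ?_
      simp [DecTuple.consEquiv, DecTuple.head, Fin.prod_univ_succ, mul_assoc]
    rw [tsum_congr step, ENNReal.tsum_mul_left, ih, pow_succ]
    ring

theorem DecTuple.tsum_inv_head_mul_prod {x : ℝ} (hx : x < 1) (s : ℕ) :
    ∑' n : DecTuple (s + 1), ENNReal.ofReal (1 / (n.1 0 : ℝ)) * ∏ i, shiftedInv x (n.1 i)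
      = ∑' b : ℕ, shiftedInv x (b + 1) * ENNReal.ofReal (1 / ((b : ℝ) + 1)) ^ (s + 1) := by
  have h1 : ∀ n : DecTuple (s + 1),
      ENNReal.ofReal (1 / (n.1 0 : ℝ)) * ∏ i, shiftedInv x (n.1 i)
        = ∑' b : ℕ, shiftedInv x (b + 1) *
          (ENNReal.ofReal (connector x n.head (b + 1)) * ∏ i, shiftedInv x (n.1 i)) := by
    intro n
    obtain ⟨m, hm⟩ := Nat.exists_eq_succ_of_ne_zero (n.2.2 0).ne'
    have h := tsum_connector_shiftedInv hx m
    rw [hm, Nat.succ_eq_add_one]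
    push_cast
    rw [← h, ← ENNReal.tsum_mul_right]
    refine tsum_congr fun b => ?_
    rw [DecTuple.head, hm]
    ring
  rw [tsum_congr h1, ENNReal.tsum_comm]
  refine tsum_congr fun b => ?_
  rw [ENNReal.tsum_mul_left, DecTuple.tsum_head_mul_prod
    (c := fun m => ENNReal.ofReal (connector x m (b + 1))) (fun m => tsum_ofReal_connector hx m b),
    connector_zero_left hx, ENNReal.ofReal_one, one_mul]

/-! ### Generating functions -/

theorem ENNReal.prod_tsum_fin {r : ℕ} (f : Fin r → ℕ → ENNReal) :
    ∏ i, ∑' e, f i e = ∑' e : Fin r → ℕ, ∏ i, f i (e i) := by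
  induction r with
  | zero => simp
  | succ r ih =>
    rw [Fin.prod_univ_succ, ih, ← (Fin.consEquiv fun _ => ℕ).tsum_eq, ENNReal.tsum_prod',
      ← ENNReal.tsum_mul_right]
    refine tsum_congr fun a => ?_
    rw [← ENNReal.tsum_mul_left]
    refine tsum_congr fun e => ?_
    simp [Fin.consEquiv, Fin.prod_univ_succ]

theorem shiftedInv_eq_tsum {x : ℝ} (hx0 : 0 < x) (hx : x < 1) {m : ℕ} (hm : 0 < m) :
    shiftedInv x m
      = ∑' e : ℕ, ENNReal.ofReal x ^ e * ENNReal.ofReal (1 / (m : ℝ)) ^ (e + 1) := by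
  have hm1 : (1 : ℝ) ≤ m := by exact_mod_cast hm
  have hlt : x * (1 / (m : ℝ)) < 1 := by
    rw [mul_one_div, div_lt_one (by linarith)]
    linarith
  have hs := (hasSum_geometric_of_lt_one (by positivity) hlt).mul_left (1 / (m : ℝ))
  have hval : 1 / (m : ℝ) * (1 - x * (1 / m))⁻¹ = 1 / ((m : ℝ) - x) := by
    have : (m : ℝ) - x ≠ 0 := by linarith
    field_simp
  rw [shiftedInv, ← hval, ← hs.tsum_eq,
    ENNReal.ofReal_tsum_of_nonneg (fun e => by positivity) hs.summable]
  refine tsum_congr fun e => ?_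
  rw [← ENNReal.ofReal_pow hx0.le, ← ENNReal.ofReal_pow (by positivity),
    ← ENNReal.ofReal_mul (by positivity)]
  congr 1
  ring

/-- The multiple zeta value with values in the extended nonnegative reals. -/
noncomputable def emultipleZeta {r : ℕ} (k : Fin r → ℕ) : ENNReal :=
  ∑' n : DecTuple r, ∏ i, ENNReal.ofReal (1 / (n.1 i : ℝ)) ^ k i

/-- The index `(e₀ + 2, e₁ + 1, …, e_s + 1)`. -/
def shiftIndex {s : ℕ} (e : Fin (s + 1) → ℕ) (i : Fin (s + 1)) : ℕ :=
  e i + 1 + if i = 0 then 1 else 0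

theorem tsum_pow_mul_emultipleZeta {x : ℝ} (hx0 : 0 < x) (hx : x < 1) (s : ℕ) :
    ∑' e : Fin (s + 1) → ℕ, emultipleZeta (shiftIndex e) * ENNReal.ofReal x ^ ∑ i, e i
      = ∑' n : DecTuple (s + 1),
        ENNReal.ofReal (1 / (n.1 0 : ℝ)) * ∏ i, shiftedInv x (n.1 i) := by
  simp only [emultipleZeta, ← ENNReal.tsum_mul_right]
  rw [ENNReal.tsum_comm]
  refine tsum_congr fun n => ?_
  simp only [fun i => shiftedInv_eq_tsum hx0 hx (n.2.2 i)]
  rw [ENNReal.prod_tsum_fin, ← ENNReal.tsum_mul_left]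
  refine tsum_congr fun e => ?_
  have hhead : ∏ i, ENNReal.ofReal (1 / (n.1 i : ℝ)) ^ (if i = 0 then 1 else 0)
      = ENNReal.ofReal (1 / (n.1 0 : ℝ)) := by
    rw [Finset.prod_eq_single 0] <;> simp +contextual
  simp only [shiftIndex, pow_add _ (_ + 1), Finset.prod_mul_distrib, Finset.prod_pow_eq_pow_sum,
    hhead]
  ring

/-- The sum of all multiple zeta values of weight `s + 2 + j` and depth `s + 1`. -/
noncomputable def ezetaSum (s j : ℕ) : ENNReal :=
  ∑' e : {e : Fin (s + 1) → ℕ // ∑ i, e i = j}, emultipleZeta (shiftIndex e.1)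

/-- The value `ζ(n)` with values in the extended nonnegative reals. -/
noncomputable def ezeta (n : ℕ) : ENNReal :=
  ∑' b : ℕ, ENNReal.ofReal (1 / ((b : ℝ) + 1)) ^ n

theorem tsum_ezetaSum_mul_pow {x : ℝ} (hx0 : 0 < x) (hx : x < 1) (s : ℕ) :
    ∑' j, ezetaSum s j * ENNReal.ofReal x ^ j
      = ∑' j, ezeta (s + 2 + j) * ENNReal.ofReal x ^ j := by
  have h1 : ∑' j, ezetaSum s j * ENNReal.ofReal x ^ j
      = ∑' e : Fin (s + 1) → ℕ, emultipleZeta (shiftIndex e) * ENNReal.ofReal x ^ ∑ i, e i := by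
    rw [← (Equiv.sigmaFiberEquiv fun e : Fin (s + 1) → ℕ => ∑ i, e i).tsum_eq,
      ENNReal.tsum_sigma']
    refine tsum_congr fun j => ?_
    rw [ezetaSum, ← ENNReal.tsum_mul_right]
    refine tsum_congr fun e => ?_
    simp only [Equiv.sigmaFiberEquiv_apply, e.2]
  rw [h1, tsum_pow_mul_emultipleZeta hx0 hx, DecTuple.tsum_inv_head_mul_prod hx]
  simp only [ezeta, ← ENNReal.tsum_mul_right]
  rw [ENNReal.tsum_comm]
  refine tsum_congr fun b => ?_
  rw [shiftedInv_eq_tsum hx0 hx b.succ_pos, ← ENNReal.tsum_mul_right]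
  refine tsum_congr fun j => ?_
  push_cast
  ring

theorem summable_one_div_succ_pow {n : ℕ} (hn : 2 ≤ n) :
    Summable fun b : ℕ => 1 / ((b : ℝ) + 1) ^ n := by
  have h := (summable_nat_add_iff 1).mpr (Real.summable_one_div_nat_pow.mpr (show 1 < n by omega))
  simpa using h

theorem ezeta_eq_ofReal {n : ℕ} (hn : 2 ≤ n) : ezeta n = ENNReal.ofReal (riemannZetaReal n) := by
  rw [riemannZetaReal, ENNReal.ofReal_tsum_of_nonneg (fun b => by positivity)
    (summable_one_div_succ_pow hn), ezeta]
  refine tsum_congr fun b => ?_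
  rw [← ENNReal.ofReal_pow (by positivity), one_div_pow]

theorem riemannZetaReal_nonneg (n : ℕ) : 0 ≤ riemannZetaReal n :=
  tsum_nonneg fun b => by positivity

theorem ezeta_antitone : Antitone ezeta := by
  intro m n hmn
  refine ENNReal.tsum_le_tsum fun b => pow_le_pow_of_le_one zero_le ?_ hmn
  rw [ENNReal.ofReal_le_one, div_le_one (by positivity)]
  linarith [(b.cast_nonneg : (0 : ℝ) ≤ b)]

theorem tsum_ezeta_mul_pow_ne_top {x : ℝ} (hx : x < 1) (s : ℕ) :
    ∑' j, ezeta (s + 2 + j) * ENNReal.ofReal x ^ j ≠ ⊤ := by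
  have hle : ∑' j, ezeta (s + 2 + j) * ENNReal.ofReal x ^ j
      ≤ ezeta 2 * ∑' j, ENNReal.ofReal x ^ j := by
    rw [← ENNReal.tsum_mul_left]
    gcongr with j
    exact ezeta_antitone (by omega)
  refine ne_top_of_le_ne_top (ENNReal.mul_ne_top ?_ ?_) hle
  · rw [ezeta_eq_ofReal le_rfl]
    exact ENNReal.ofReal_ne_top
  · rw [ENNReal.tsum_geometric, ENNReal.inv_ne_top]
    exact (tsub_pos_of_lt (ENNReal.ofReal_lt_one.mpr hx)).ne'

theorem ezetaSum_eq (s j : ℕ) : ezetaSum s j = ezeta (s + 2 + j) :=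
  coeff_eq_of_forall_tsum_mul_pow_eq j (b := fun j => ezeta (s + 2 + j))
    (fun _ hx0 hx => tsum_ezetaSum_mul_pow hx0 hx s)
    (fun _ _ hx => tsum_ezeta_mul_pow_ne_top hx s)

/-! ### The sum formula -/

theorem toReal_emultipleZeta {r : ℕ} (k : Fin r → ℕ) :
    (emultipleZeta k).toReal = multipleZeta k := by
  rw [emultipleZeta, ENNReal.tsum_toReal_eq, multipleZeta]
  · refine tsum_congr fun n => ?_
    rw [ENNReal.toReal_prod, one_div, ← Finset.prod_inv_distrib]
    refine Finset.prod_congr rfl fun i _ => ?_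
    rw [ENNReal.toReal_pow, ENNReal.toReal_ofReal (by positivity), one_div, inv_pow]
  · exact fun n => ENNReal.prod_ne_top fun i _ => ENNReal.pow_ne_top ENNReal.ofReal_ne_top

theorem sum_shiftIndex {s : ℕ} (e : Fin (s + 1) → ℕ) :
    ∑ i, shiftIndex e i = ∑ i, e i + (s + 2) := by
  simp [shiftIndex, Finset.sum_add_distrib, add_assoc]

/-- Admissible indices of weight `s + 2 + j` and depth `s + 1` are the shifts of tuples of
weight `j`. -/
def shiftIndexEquiv (s j : ℕ) : {e : Fin (s + 1) → ℕ // ∑ i, e i = j} ≃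
    {k : Fin (s + 1) → ℕ // (∀ i, 1 ≤ k i) ∧ (∀ h : 0 < s + 1, 2 ≤ k ⟨0, h⟩) ∧
      (∑ i, k i) = s + 2 + j} where
  toFun e := ⟨shiftIndex e.1, fun i => by simp only [shiftIndex]; omega,
    fun h => by simp [shiftIndex], by rw [sum_shiftIndex, e.2]; ring⟩
  invFun k := ⟨fun i => k.1 i - (1 + if i = 0 then 1 else 0), by
    have hk : shiftIndex (fun i => k.1 i - (1 + if i = 0 then 1 else 0)) = k.1 := by
      funext i
      have h1 := k.2.1 i
      have h2 : 2 ≤ k.1 0 := k.2.2.1 s.succ_pos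
      simp only [shiftIndex]
      split_ifs with h
      · subst h
        omega
      · omega
    have h := sum_shiftIndex (fun i => k.1 i - (1 + if i = 0 then 1 else 0))
    rw [hk, k.2.2.2] at h
    exact (Nat.add_right_cancel ((add_comm _ _).trans h)).symm⟩
  left_inv e := by
    ext i
    simp only [shiftIndex]
    omega
  right_inv k := by
    ext i
    have h1 := k.2.1 i
    have h2 : 2 ≤ k.1 0 := k.2.2.1 s.succ_pos
    simp only [shiftIndex]
    split_ifs with h
    · subst h
      omega
    · omega

/-- The sum formula: the multiple zeta values of weight `n` and depth `d` add up to `ζ(n)`. -/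
theorem zetaSum_eq_riemannZetaReal {n d : ℕ} (hd : 1 ≤ d) (hdn : d < n) :
    zetaSum n d = riemannZetaReal n := by
  obtain ⟨s, rfl⟩ := Nat.exists_eq_add_of_le' hd
  obtain ⟨j, rfl⟩ := Nat.exists_eq_add_of_le (show s + 2 ≤ n by omega)
  have hfin : ezetaSum s j ≠ ⊤ := by
    rw [ezetaSum_eq, ezeta_eq_ofReal (by omega)]
    exact ENNReal.ofReal_ne_top
  rw [zetaSum, ← (shiftIndexEquiv s j).tsum_eq,
    ← ENNReal.toReal_ofReal (riemannZetaReal_nonneg (s + 2 + j)), ← ezeta_eq_ofReal (by omega),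
    ← ezetaSum_eq, ezetaSum, ENNReal.tsum_toReal_eq (ENNReal.ne_top_of_tsum_ne_top hfin)]
  exact tsum_congr fun e => (toReal_emultipleZeta _).symm

/-- For `2 ≤ k ≤ n`, `∑_{d = k-1}^{n-1} C(d-1, k-2) · S(n, d) = C(n-1, k-1) · ζ(n)`. -/
theorem weighted_sum_formula (k n : ℕ) (hk : 2 ≤ k) (hkn : k ≤ n) :
    ∑ d ∈ Finset.Icc (k - 1) (n - 1), ((d - 1).choose (k - 2) : ℝ) * zetaSum n d
      = ((n - 1).choose (k - 1) : ℝ) * riemannZetaReal n := by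
  obtain ⟨k, rfl⟩ := Nat.exists_eq_add_of_le' hk
  obtain ⟨n, rfl⟩ := Nat.exists_eq_add_of_le' (hk.trans hkn)
  have hsum : ∑ d ∈ Finset.Icc (k + 1) (n + 1), (d - 1).choose k = (n + 1).choose (k + 1) := by
    rw [← Nat.sum_Icc_choose, ← Finset.map_add_right_Icc, Finset.sum_map]
    simp
  rw [show k + 2 - 1 = k + 1 by omega, show n + 2 - 1 = n + 1 by omega,
    show k + 2 - 2 = k by omega, ← hsum, Nat.cast_sum, Finset.sum_mul]
  refine Finset.sum_congr rfl fun d hd => ?_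
  rw [Finset.mem_Icc] at hd
  rw [zetaSum_eq_riemannZetaReal (by omega) (by omega)]
end

section
/- Euler connection formula for polylogarithms: for every integer k ≥ 2 and every real z with 0 < z < 1, ∑_{j=0}^{k−1} Li_{k−j}(z) · (−log z)^j / j! + Li_{2,1,…,1}(1−z) = ζ(k), where in the last term the index is (2,1,…,1) with k−2 ones, i.e. Li_{2,1,…,1}(1−z) = ∑_{n₁>n₂>⋯>n_{k−1}>0} (1−z)^{n₁}/(n₁² n₂ ⋯ n_{k−1}). -/
open scoped BigOperators

/-- The polylogarithm `Li_k(z) = ∑_{n ≥ 1} z^n / n^k`. -/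
noncomputable def polylog (k : ℕ) (z : ℝ) : ℝ :=
  ∑' n : ℕ, z ^ (n + 1) / ((n : ℝ) + 1) ^ k

open Filter Topology

section PowerSeries

/-- Termwise differentiation of a real power series inside the unit disc. -/
theorem hasDerivAt_tsum_div_mul_pow_succ {c : ℕ → ℝ} (hc : ∀ n, |c n| ≤ n + 1) {x : ℝ}
    (hx : |x| < 1) :
    HasDerivAt (fun y => ∑' n : ℕ, c n / (n + 1) * y ^ (n + 1)) (∑' n : ℕ, c n * x ^ n) x := by
  obtain ⟨r, hxr, hr1⟩ := exists_between hx
  have hr0 : 0 ≤ r := (abs_nonneg x).trans hxr.le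
  have hu : Summable fun n : ℕ => ((n : ℝ) + 1) * r ^ n := by
    have hr : ‖r‖ < 1 := by rwa [Real.norm_of_nonneg hr0]
    simpa [add_mul] using (summable_pow_mul_geometric_of_norm_lt_one 1 hr).add
      (summable_geometric_of_norm_lt_one hr)
  refine hasDerivAt_tsum_of_isPreconnected (t := Set.Ioo (-r) r)
    (g := fun n y => c n / (n + 1) * y ^ (n + 1)) (g' := fun n y => c n * y ^ n) (y₀ := 0)
    hu isOpen_Ioo isPreconnected_Ioo (fun n y _ => ?_) (fun n y hy => ?_) ?_ ?_ (abs_lt.1 hxr)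
  · have hn : (n : ℝ) + 1 ≠ 0 := by positivity
    convert! (hasDerivAt_pow (n + 1) y).const_mul (c n / (n + 1)) using 1
    push_cast
    field_simp
  · rw [Real.norm_eq_abs, abs_mul, abs_pow]
    exact mul_le_mul (hc n) (pow_le_pow_left₀ (abs_nonneg y) (abs_lt.2 hy).le n)
      (by positivity) (by positivity)
  · have : 0 < r := (abs_nonneg x).trans_lt hxr
    exact ⟨by linarith, this⟩
  · simp

theorem summable_mul_pow_of_abs_le {c : ℕ → ℝ} (hc : ∀ n, |c n| ≤ n + 1) {x : ℝ}
    (hx : |x| < 1) : Summable fun n => c n * x ^ n := by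
  have hr : ‖|x|‖ < 1 := by simpa using hx
  have hu : Summable fun n : ℕ => ((n : ℝ) + 1) * |x| ^ n := by
    simpa [add_mul] using (summable_pow_mul_geometric_of_norm_lt_one 1 hr).add
      (summable_geometric_of_norm_lt_one hr)
  refine .of_norm_bounded hu fun n => ?_
  rw [Real.norm_eq_abs, abs_mul, abs_pow]
  exact mul_le_mul_of_nonneg_right (hc n) (by positivity)

/-- Two functions with the same derivative on an open interval that agree at one of its points
agree on the interval. -/
theorem eqOn_Ioo_of_hasDerivAt {f g f' : ℝ → ℝ} {a b x₀ : ℝ}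
    (hf : ∀ x ∈ Set.Ioo a b, HasDerivAt f (f' x) x)
    (hg : ∀ x ∈ Set.Ioo a b, HasDerivAt g (f' x) x)
    (hx₀ : x₀ ∈ Set.Ioo a b) (h : f x₀ = g x₀) : Set.EqOn f g (Set.Ioo a b) :=
  isOpen_Ioo.eqOn_of_deriv_eq isPreconnected_Ioo
    (fun x hx => (hf x hx).differentiableAt.differentiableWithinAt)
    (fun x hx => (hg x hx).differentiableAt.differentiableWithinAt)
    (fun x hx => by rw [(hf x hx).deriv, (hg x hx).deriv]) hx₀ h

end PowerSeries

section NestedSum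

/-- The nested harmonic sum `∑_{N > n₁ > ⋯ > n_m > 0} 1 / (n₁ ⋯ n_m)`. -/
noncomputable def nestedHarmonic : ℕ → ℕ → ℝ
  | 0, _ => 1
  | m + 1, N => ∑ M ∈ Finset.range N, nestedHarmonic m M / M

theorem nestedHarmonic_nonneg (m N : ℕ) : 0 ≤ nestedHarmonic m N := by
  induction m generalizing N with
  | zero => simp [nestedHarmonic]
  | succ m ih =>
    exact Finset.sum_nonneg fun M _ => div_nonneg (ih M) M.cast_nonneg

theorem nestedHarmonic_div_le_one (m N : ℕ) : nestedHarmonic m N / N ≤ 1 := by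
  induction m generalizing N with
  | zero => simpa [nestedHarmonic] using Nat.cast_inv_le_one N
  | succ m ih =>
    refine div_le_one_of_le₀ ?_ N.cast_nonneg
    exact (Finset.sum_le_sum fun M _ => ih M).trans (by simp)

theorem nestedHarmonic_succ_succ (m N : ℕ) :
    nestedHarmonic (m + 1) (N + 1) = nestedHarmonic (m + 1) N + nestedHarmonic m N / N :=
  Finset.sum_range_succ _ _

theorem abs_nestedHarmonic_succ_le (m n : ℕ) : |nestedHarmonic m (n + 1)| ≤ n + 1 := by
  rw [abs_of_nonneg (nestedHarmonic_nonneg _ _)]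
  have h := nestedHarmonic_div_le_one m (n + 1)
  rw [div_le_one (by positivity)] at h
  exact_mod_cast h

theorem abs_nestedHarmonic_succ_div_le (m n : ℕ) :
    |nestedHarmonic m (n + 1) / (n + 1)| ≤ 1 := by
  rw [abs_div, abs_of_nonneg (by positivity : (0 : ℝ) ≤ n + 1), div_le_one (by positivity)]
  exact abs_nestedHarmonic_succ_le m n

/-- The generating function of the strictly nested sums: `Li_{1,…,1}(w)` with `m + 1` ones is
`(-log (1 - w)) ^ (m + 1) / (m + 1)!`. -/
theorem tsum_nestedHarmonic_mul_pow (m : ℕ) {w : ℝ} (hw : w ∈ Set.Ioo (-1 : ℝ) 1) :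
    ∑' n : ℕ, nestedHarmonic m (n + 1) / (n + 1) * w ^ (n + 1) =
      (-Real.log (1 - w)) ^ (m + 1) / (m + 1).factorial := by
  have hderiv (j : ℕ) (x : ℝ) (hx : x ∈ Set.Ioo (-1 : ℝ) 1) :
      HasDerivAt (fun w => (-Real.log (1 - w)) ^ (j + 1) / (j + 1).factorial)
        ((-Real.log (1 - x)) ^ j / j.factorial / (1 - x)) x := by
    have h1 : 1 - x ≠ 0 := by linarith [hx.2]
    have := (((((hasDerivAt_id x).const_sub 1).log h1).neg).pow (j + 1)).div_const
      ((j + 1).factorial : ℝ)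
    convert! this using 1
    have hj : (j.factorial : ℝ) ≠ 0 := by positivity
    simp only [Nat.factorial_succ, Nat.add_sub_cancel, id, Pi.neg_apply]
    push_cast
    field_simp
  induction m generalizing w with
  | zero =>
    refine eqOn_Ioo_of_hasDerivAt (f' := fun x => (1 - x)⁻¹)
      (f := fun w => ∑' n : ℕ, nestedHarmonic 0 (n + 1) / (n + 1) * w ^ (n + 1))
      (g := fun w => (-Real.log (1 - w)) ^ (0 + 1) / (0 + 1).factorial)
      (x₀ := 0) (fun x hx => ?_) (fun x hx => ?_) (by simp) (by simp) hw
    · convert! hasDerivAt_tsum_div_mul_pow_succ (abs_nestedHarmonic_succ_le 0) (abs_lt.2 hx)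
        using 1
      simp [nestedHarmonic, tsum_geometric_of_abs_lt_one (abs_lt.2 hx)]
    · simpa using hderiv 0 x hx
  | succ m ih =>
    refine eqOn_Ioo_of_hasDerivAt
      (f' := fun x => (-Real.log (1 - x)) ^ (m + 1) / (m + 1).factorial / (1 - x))
      (f := fun w => ∑' n : ℕ, nestedHarmonic (m + 1) (n + 1) / (n + 1) * w ^ (n + 1))
      (g := fun w => (-Real.log (1 - w)) ^ (m + 1 + 1) / (m + 1 + 1).factorial)
      (x₀ := 0) (fun x hx => ?_) (fun x hx => hderiv (m + 1) x hx) (by simp) (by simp) hw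
    convert! hasDerivAt_tsum_div_mul_pow_succ (abs_nestedHarmonic_succ_le (m + 1)) (abs_lt.2 hx)
      using 1
    have h1 : 1 - x ≠ 0 := by linarith [hx.2]
    rw [div_eq_iff h1, ← ih hx]
    have hs := summable_mul_pow_of_abs_le (abs_nestedHarmonic_succ_le (m + 1)) (abs_lt.2 hx)
    have hs' : Summable fun n : ℕ => nestedHarmonic (m + 1) (n + 1 + 1) * x ^ (n + 1) :=
      (summable_nat_add_iff 1).2 hs
    have h0 : nestedHarmonic (m + 1) (0 + 1) = 0 := by simp [nestedHarmonic]
    rw [mul_sub, mul_one, ← tsum_mul_right]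
    nth_rw 1 [hs.tsum_eq_zero_add]
    rw [h0, zero_mul, zero_add, ← hs'.tsum_sub (hs.mul_right x)]
    refine tsum_congr fun n => ?_
    rw [nestedHarmonic_succ_succ m (n + 1)]
    push_cast
    ring

end NestedSum

section TupleSum

/-- Fubini for nonnegative families, with the value of the sum. -/
theorem HasSum.of_prod_fiberwise_of_nonneg {α β : Type*} {f : α × β → ℝ} {g : α → ℝ} {a : ℝ}
    (hf : 0 ≤ f) (hfg : ∀ x, HasSum (fun y => f (x, y)) (g x)) (hg : HasSum g a) :
    HasSum f a := by
  have hs : Summable f := (summable_prod_of_nonneg hf).2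
    ⟨fun x => (hfg x).summable, by simpa only [(hfg _).tsum_eq] using hg.summable⟩
  rw [← (hs.hasSum.prod_fiberwise hfg).unique hg]
  exact hs.hasSum

open Classical in
theorem hasSum_strictAnti_cons (m N : ℕ) :
    HasSum (fun t : Fin m → ℕ =>
      if StrictAnti (Fin.cons N t : Fin (m + 1) → ℕ) then ∏ i, (t i : ℝ)⁻¹ else 0)
      (nestedHarmonic m N) := by
  induction m generalizing N with
  | zero =>
    simp [nestedHarmonic, Subsingleton.strictAnti]
  | succ m ih =>
    rw [← (Fin.consEquiv fun _ : Fin (m + 1) => ℕ).hasSum_iff]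
    refine HasSum.of_prod_fiberwise_of_nonneg
      (g := fun M => if M < N then nestedHarmonic m M / M else 0) ?_ (fun M => ?_) ?_
    · intro p
      dsimp only [Function.comp, Pi.zero_apply]
      split_ifs
      · positivity
      · exact le_rfl
    · have hcons (t : Fin m → ℕ) :
          StrictAnti (Fin.cons N (Fin.cons M t : Fin (m + 1) → ℕ) : Fin (m + 2) → ℕ) ↔
            M < N ∧ StrictAnti (Fin.cons M t : Fin (m + 1) → ℕ) :=
        strictAnti_vecCons
      change HasSum (fun t : Fin m → ℕ =>
        if StrictAnti (Fin.cons N (Fin.cons M t : Fin (m + 1) → ℕ) : Fin (m + 2) → ℕ) then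
          ∏ i, ((Fin.cons M t : Fin (m + 1) → ℕ) i : ℝ)⁻¹ else 0) _
      by_cases hMN : M < N
      · simp only [hcons, hMN, true_and, if_true,
          Fin.prod_univ_succ, Fin.cons_zero, Fin.cons_succ]
        convert! (ih M).mul_left (M : ℝ)⁻¹ using 1
        · ext t
          simp
        · rw [div_eq_inv_mul]
      · simp only [hcons, hMN, false_and, if_false]
        exact hasSum_zero
    · have h := hasSum_sum_of_ne_finset_zero (L := .unconditional ℕ) (s := Finset.range N)
        (f := fun M : ℕ => if M < N then nestedHarmonic m M / M else 0)
        (fun M hM => if_neg (by simpa using hM))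
      convert! h using 1
      exact Finset.sum_congr rfl fun M hM => (if_pos (Finset.mem_range.1 hM)).symm

/-- A sum over strictly decreasing tuples of positive integers, weighted by a nonnegative function
of the largest entry, as a single series in that entry. -/
theorem tsum_strictAnti_eq (m : ℕ) {f : ℕ → ℝ} (hf : ∀ N, 0 ≤ f N) (hf0 : f 0 = 0)
    (hs : Summable fun N => f N * nestedHarmonic m N) :
    ∑' n : {n : Fin (m + 1) → ℕ // StrictAnti n ∧ ∀ i, 0 < n i},
      f (n.1 0) * ∏ i : Fin m, (n.1 i.succ : ℝ)⁻¹ = ∑' N, f N * nestedHarmonic m N := by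
  classical
  let F : (Fin (m + 1) → ℕ) → ℝ := fun n =>
    if StrictAnti n then f (n 0) * ∏ i : Fin m, (n i.succ : ℝ)⁻¹ else 0
  have hF : HasSum F (∑' N, f N * nestedHarmonic m N) := by
    rw [← (Fin.consEquiv fun _ : Fin (m + 1) => ℕ).hasSum_iff]
    refine HasSum.of_prod_fiberwise_of_nonneg (fun p => ?_) (fun N => ?_) hs.hasSum
    · dsimp only [F, Function.comp, Pi.zero_apply]
      split_ifs
      · exact mul_nonneg (hf _) (by positivity)
      · exact le_rfl
    · convert! (hasSum_strictAnti_cons m N).mul_left (f N) using 1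
      ext t
      change (if StrictAnti (Fin.cons N t : Fin (m + 1) → ℕ) then
        f N * ∏ i, (t i : ℝ)⁻¹ else 0) = _
      rw [mul_ite, mul_zero]
  rw [← hF.tsum_eq, ← tsum_subtype_eq_of_support_subset
    (s := {n : Fin (m + 1) → ℕ | StrictAnti n ∧ ∀ i, 0 < n i})]
  · exact tsum_congr fun n => (if_pos n.2.1).symm
  · intro n hn
    by_cases ha : StrictAnti n
    · refine ⟨ha, fun i => Nat.pos_of_ne_zero fun hi => hn ?_⟩
      simp only [F, if_pos ha]
      refine Fin.cases (fun h => ?_) (fun j hj => ?_) i hi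
      · rw [h, hf0, zero_mul]
      · rw [Finset.prod_eq_zero (Finset.mem_univ j) (by simp [hj]), mul_zero]
    · exact absurd (if_neg ha) hn

end TupleSum

section Polylog

theorem polylog_succ_eq (k : ℕ) (z : ℝ) :
    polylog (k + 1) z = ∑' n : ℕ, 1 / ((n : ℝ) + 1) ^ k / (n + 1) * z ^ (n + 1) := by
  refine tsum_congr fun n => ?_
  field_simp
  ring

theorem polylog_zero_eq {z : ℝ} (hz : |z| < 1) : polylog 0 z = z / (1 - z) := by
  simp only [polylog, pow_zero, div_one, pow_succ']
  rw [tsum_mul_left, tsum_geometric_of_abs_lt_one hz, div_eq_mul_inv]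

theorem hasDerivAt_polylog_succ (k : ℕ) {z : ℝ} (hz0 : z ≠ 0) (hz : |z| < 1) :
    HasDerivAt (polylog (k + 1)) (polylog k z / z) z := by
  have hc (n : ℕ) : |1 / ((n : ℝ) + 1) ^ k| ≤ n + 1 := by
    have h1 : (1 : ℝ) ≤ n + 1 := by linarith [n.cast_nonneg (α := ℝ)]
    rw [abs_of_nonneg (by positivity)]
    exact (div_le_one_of_le₀ (one_le_pow₀ h1) (by positivity)).trans h1
  convert! hasDerivAt_tsum_div_mul_pow_succ hc hz using 1
  · exact funext (polylog_succ_eq k)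
  · rw [polylog, ← tsum_div_const]
    refine tsum_congr fun n => ?_
    field_simp
    ring

theorem polylog_one_eq {z : ℝ} (hz : |z| < 1) : polylog 1 z = -Real.log (1 - z) := by
  rw [← (Real.hasSum_pow_div_log_of_abs_lt_one hz).tsum_eq]
  simp [polylog]

theorem polylog_at_one (k : ℕ) : polylog k 1 = riemannZetaReal k := by
  simp [polylog, riemannZetaReal]

theorem continuousOn_polylog {k : ℕ} (hk : 2 ≤ k) : ContinuousOn (polylog k) (Set.Icc 0 1) := by
  have hs : Summable fun n : ℕ => 1 / ((n : ℝ) + 1) ^ k := by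
    simpa using (summable_nat_add_iff 1).2 (Real.summable_one_div_nat_pow.2 (by omega : 1 < k))
  refine continuousOn_tsum (fun n => by fun_prop) hs fun n x hx => ?_
  rw [Real.norm_of_nonneg (div_nonneg (pow_nonneg hx.1 _) (by positivity))]
  gcongr
  exact pow_le_one₀ hx.1 hx.2

theorem tendsto_polylog_one {k : ℕ} (hk : 2 ≤ k) :
    Tendsto (polylog k) (𝓝[<] 1) (𝓝 (riemannZetaReal k)) := by
  rw [← polylog_at_one, ← nhdsWithin_Ioo_eq_nhdsLT (zero_lt_one (α := ℝ))]
  exact ((continuousOn_polylog hk) 1 (by simp)).mono_left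
    (nhdsWithin_mono _ Set.Ioo_subset_Icc_self)

theorem tendsto_neg_log_one : Tendsto (fun z => -Real.log z) (𝓝[<] 1) (𝓝 0) := by
  have h := (Real.continuousAt_log one_ne_zero).neg.tendsto
  simp only [Pi.neg_apply, Real.log_one, neg_zero] at h
  exact h.mono_left nhdsWithin_le_nhds

/-- The divergence of `Li₁` at `1` is killed by one factor of `log z`. -/
theorem tendsto_polylog_one_mul_neg_log :
    Tendsto (fun z => polylog 1 z * -Real.log z) (𝓝[<] 1) (𝓝 0) := by
  have hsub : Tendsto (fun z : ℝ => 1 - z) (𝓝[<] 1) (𝓝[>] 0) := by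
    refine tendsto_nhdsWithin_iff.2 ⟨?_, ?_⟩
    · have : Tendsto (fun z : ℝ => 1 - z) (𝓝 1) (𝓝 (1 - 1)) := by
        exact (continuous_const.sub continuous_id).tendsto 1
      rw [sub_self] at this
      exact this.mono_left nhdsWithin_le_nhds
    · filter_upwards [self_mem_nhdsWithin] with z hz
      simpa using hz
  have hlog : Tendsto (fun z : ℝ => Real.log (1 - z) * (1 - z)) (𝓝[<] 1) (𝓝 0) := by
    simpa [Function.comp_def] using (tendsto_log_mul_rpow_nhdsGT_zero zero_lt_one).comp hsub
  have hinv : Tendsto (fun z : ℝ => z⁻¹) (𝓝[<] 1) (𝓝 1) := by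
    simpa using (tendsto_inv₀ (one_ne_zero (α := ℝ))).mono_left nhdsWithin_le_nhds
  have hbound := (hlog.neg).mul hinv
  simp only [neg_zero, zero_mul] at hbound
  refine tendsto_of_tendsto_of_tendsto_of_le_of_le' tendsto_const_nhds hbound ?_ ?_
  all_goals
    filter_upwards [Ioo_mem_nhdsLT (zero_lt_one (α := ℝ))] with z hz
    rw [polylog_one_eq (abs_lt.2 ⟨by linarith [hz.1], hz.2⟩)]
    have h1 : Real.log (1 - z) ≤ 0 := Real.log_nonpos (by linarith [hz.2]) (by linarith [hz.1])
    have h2 : Real.log z ≤ 0 := Real.log_nonpos hz.1.le hz.2.le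
  · exact mul_nonneg (by linarith) (by linarith)
  · have h3 := Real.one_sub_inv_le_log_of_pos hz.1
    have h4 : (1 - z) * z⁻¹ = z⁻¹ - 1 := by
      have := hz.1.ne'
      field_simp
    calc -Real.log (1 - z) * -Real.log z ≤ -Real.log (1 - z) * (z⁻¹ - 1) :=
          mul_le_mul_of_nonneg_left (by linarith) (by linarith)
      _ = -(Real.log (1 - z) * (1 - z)) * z⁻¹ := by rw [← h4]; ring

end Polylog

section Connection

/-- The sum of products of polylogarithms and powers of the logarithm telescopes under
differentiation. -/
theorem hasDerivAt_sum_polylog_mul_log (m : ℕ) {z : ℝ} (hz : z ∈ Set.Ioo (0 : ℝ) 1) :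
    HasDerivAt (fun z => ∑ j ∈ Finset.range (m + 1),
        polylog (m + 1 - j) z * (-Real.log z) ^ j / (j.factorial : ℝ))
      ((-Real.log z) ^ m / m.factorial / (1 - z)) z := by
  have hz0 : z ≠ 0 := hz.1.ne'
  have hzabs : |z| < 1 := abs_lt.2 ⟨by linarith [hz.1], hz.2⟩
  let g : ℕ → ℝ := fun j =>
    polylog (m + 1 - j) z * (j * (-Real.log z) ^ (j - 1)) / j.factorial / z
  have hterm (j : ℕ) (hj : j ∈ Finset.range (m + 1)) :
      HasDerivAt (fun z => polylog (m + 1 - j) z * (-Real.log z) ^ j / (j.factorial : ℝ))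
        (g (j + 1) - g j) z := by
    obtain ⟨i, rfl⟩ := Nat.exists_eq_add_of_le (Nat.lt_succ_iff.1 (Finset.mem_range.1 hj))
    have e1 : j + i + 1 - j = i + 1 := by omega
    have e2 : j + i + 1 - (j + 1) = i := by omega
    simp only [g, e1, e2]
    convert! ((hasDerivAt_polylog_succ i hz0 hzabs).mul
      ((Real.hasDerivAt_log hz0).neg.pow j)).div_const (j.factorial : ℝ) using 1
    have hj0 : (j.factorial : ℝ) ≠ 0 := by positivity
    simp only [Nat.factorial_succ, Nat.add_sub_cancel, Pi.neg_apply, Pi.pow_apply]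
    push_cast
    field_simp
    ring
  convert! HasDerivAt.fun_sum hterm using 1
  rw [Finset.sum_range_sub]
  have hm : (m.factorial : ℝ) ≠ 0 := by positivity
  have h1 : 1 - z ≠ 0 := by linarith [hz.2]
  simp only [g, Nat.sub_self, polylog_zero_eq hzabs, Nat.factorial_succ, Nat.add_sub_cancel]
  push_cast
  field_simp
  ring

/-- The single series form of `Li_{2,1,…,1}` with `m` ones has derivative
`Li_{1,…,1}(w) / w` with `m + 1` ones. -/
theorem hasDerivAt_tsum_nestedHarmonic_div_sq (m : ℕ) {w : ℝ} (hw : w ∈ Set.Ioo (0 : ℝ) 1) :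
    HasDerivAt
      (fun w => ∑' n : ℕ, nestedHarmonic m (n + 1) / (n + 1) / (n + 1) * w ^ (n + 1))
      ((-Real.log (1 - w)) ^ (m + 1) / (m + 1).factorial / w) w := by
  have hw' : w ∈ Set.Ioo (-1 : ℝ) 1 := ⟨by linarith [hw.1], hw.2⟩
  convert! hasDerivAt_tsum_div_mul_pow_succ (fun n =>
    (abs_nestedHarmonic_succ_div_le m n).trans (by linarith [n.cast_nonneg (α := ℝ)]))
    (abs_lt.2 hw') using 1
  rw [← tsum_nestedHarmonic_mul_pow m hw', ← tsum_div_const]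
  refine tsum_congr fun n => ?_
  have := hw.1.ne'
  field_simp
  ring

theorem tendsto_tsum_nestedHarmonic_div_sq (m : ℕ) :
    Tendsto (fun z : ℝ =>
      ∑' n : ℕ, nestedHarmonic m (n + 1) / (n + 1) / (n + 1) * (1 - z) ^ (n + 1))
      (𝓝[<] 1) (𝓝 0) := by
  have hcont := (hasDerivAt_tsum_div_mul_pow_succ (x := 0) (fun n =>
    (abs_nestedHarmonic_succ_div_le m n).trans (by linarith [n.cast_nonneg (α := ℝ)]))
    (by simp)).continuousAt.tendsto
  have hsub : Tendsto (fun z : ℝ => 1 - z) (𝓝[<] 1) (𝓝 0) := by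
    have : Tendsto (fun z : ℝ => 1 - z) (𝓝 1) (𝓝 (1 - 1)) :=
      (continuous_const.sub continuous_id).tendsto 1
    rw [sub_self] at this
    exact this.mono_left nhdsWithin_le_nhds
  simpa [Function.comp_def] using hcont.comp hsub

theorem tendsto_sum_polylog_mul_log (m : ℕ) :
    Tendsto (fun z => ∑ j ∈ Finset.range (m + 2),
        polylog (m + 2 - j) z * (-Real.log z) ^ j / (j.factorial : ℝ))
      (𝓝[<] 1) (𝓝 (riemannZetaReal (m + 2))) := by
  simp only [Finset.sum_range_succ' _ (m + 1)]
  rw [← zero_add (riemannZetaReal (m + 2))]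
  refine Tendsto.add ?_ (by simpa using tendsto_polylog_one (by omega : 2 ≤ m + 2))
  rw [← Finset.sum_const_zero (s := Finset.range (m + 1))]
  refine tendsto_finsetSum _ fun j hj => ?_
  rw [← zero_div ((j + 1).factorial : ℝ)]
  refine Tendsto.div_const ?_ _
  rcases (Nat.lt_succ_iff.1 (Finset.mem_range.1 hj)).eq_or_lt with rfl | hlt
  · have e : j + 2 - (j + 1) = 1 := by omega
    simp only [e, pow_succ', ← mul_assoc]
    simpa using tendsto_polylog_one_mul_neg_log.mul (tendsto_neg_log_one.pow j)
  · simpa using (tendsto_polylog_one (by omega : 2 ≤ m + 2 - (j + 1))).mul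
      (tendsto_neg_log_one.pow (j + 1))

/-- The connection formula with `Li_{2,1,…,1}` written as a single series. -/
theorem sum_polylog_mul_log_add_tsum (m : ℕ) {z : ℝ} (hz : z ∈ Set.Ioo (0 : ℝ) 1) :
    (∑ j ∈ Finset.range (m + 2),
        polylog (m + 2 - j) z * (-Real.log z) ^ j / (j.factorial : ℝ)) +
      ∑' n : ℕ, nestedHarmonic m (n + 1) / (n + 1) / (n + 1) * (1 - z) ^ (n + 1) =
      riemannZetaReal (m + 2) := by
  let F : ℝ → ℝ := fun z => (∑ j ∈ Finset.range (m + 2),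
        polylog (m + 2 - j) z * (-Real.log z) ^ j / (j.factorial : ℝ)) +
      ∑' n : ℕ, nestedHarmonic m (n + 1) / (n + 1) / (n + 1) * (1 - z) ^ (n + 1)
  have hF (x : ℝ) (hx : x ∈ Set.Ioo (0 : ℝ) 1) : HasDerivAt F 0 x := by
    have hw : 1 - x ∈ Set.Ioo (0 : ℝ) 1 := ⟨by linarith [hx.2], by linarith [hx.1]⟩
    have h := (hasDerivAt_sum_polylog_mul_log (m + 1) hx).add
      ((hasDerivAt_tsum_nestedHarmonic_div_sq m hw).comp x ((hasDerivAt_id x).const_sub 1))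
    convert! h using 1
    simp
  have hconst : Set.EqOn F (fun _ => F z) (Set.Ioo 0 1) :=
    eqOn_Ioo_of_hasDerivAt (f' := fun _ => 0) hF (fun x _ => hasDerivAt_const x _) hz rfl
  have hlim : Tendsto F (𝓝[<] 1) (𝓝 (riemannZetaReal (m + 2))) := by
    simpa using (tendsto_sum_polylog_mul_log m).add (tendsto_tsum_nestedHarmonic_div_sq m)
  refine tendsto_nhds_unique (tendsto_const_nhds.congr' ?_) hlim
  filter_upwards [Ioo_mem_nhdsLT (zero_lt_one (α := ℝ))] with x hx
  exact (hconst hx).symm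

end Connection

/-- Euler connection formula for polylogarithms: for `k ≥ 2` and `0 < z < 1`,
`∑_{j=0}^{k-1} Li_{k-j}(z) · (-log z)^j / j! + Li_{2,1,…,1}(1-z) = ζ(k)`,
where the last multiple polylogarithm has index `(2, 1, …, 1)` with `k - 2` ones,
i.e. is `∑_{n₁ > ⋯ > n_{k-1} > 0} (1-z)^{n₁} / (n₁² n₂ ⋯ n_{k-1})`. -/
theorem euler_connection_polylog (k : ℕ) (hk : 2 ≤ k) (z : ℝ)
    (hz0 : 0 < z) (hz1 : z < 1) :
    (∑ j ∈ Finset.range k,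
        polylog (k - j) z * (-Real.log z) ^ j / (Nat.factorial j : ℝ)) +
      (∑' n : {n : Fin (k - 1) → ℕ // StrictAnti n ∧ ∀ i, 0 < n i},
        (1 - z) ^ (n.1 ⟨0, by omega⟩) /
          (((n.1 ⟨0, by omega⟩ : ℝ)) ^ 2 *
            ∏ i ∈ Finset.univ.erase (⟨0, by omega⟩ : Fin (k - 1)), (n.1 i : ℝ)))
      = riemannZetaReal k := by
  obtain ⟨m, rfl⟩ := Nat.exists_eq_add_of_le' hk
  rw [← sum_polylog_mul_log_add_tsum m ⟨hz0, hz1⟩]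
  congr 1
  let f : ℕ → ℝ := fun N => (1 - z) ^ N / (N : ℝ) ^ 2
  have hw : |1 - z| < 1 := abs_lt.2 ⟨by linarith, by linarith⟩
  have hterm (n : ℕ) : f (n + 1) * nestedHarmonic m (n + 1) =
      nestedHarmonic m (n + 1) / (n + 1) / (n + 1) * (1 - z) ^ (n + 1) := by
    simp only [f]
    push_cast
    field_simp
  have hs : Summable fun N => f N * nestedHarmonic m N := by
    rw [← summable_nat_add_iff 1]
    simp only [hterm, pow_succ, ← mul_assoc]
    refine (summable_mul_pow_of_abs_le (fun n => ?_) hw).mul_right _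
    have h1 : (1 : ℝ) ≤ n + 1 := by linarith [n.cast_nonneg (α := ℝ)]
    rw [abs_div, abs_of_nonneg (by positivity : (0 : ℝ) ≤ n + 1)]
    exact (div_le_one_of_le₀ ((abs_nestedHarmonic_succ_div_le m n).trans h1)
      (by positivity)).trans h1
  have hsum := tsum_strictAnti_eq m
    (fun N => div_nonneg (pow_nonneg (by linarith) N) (by positivity)) (by simp) hs
  rw [hs.tsum_eq_zero_add] at hsum
  simp only [hterm] at hsum
  have hf0 : f 0 = 0 := by simp [f]
  rw [hf0, zero_mul, zero_add] at hsum
  rw [← hsum]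
  refine tsum_congr fun n => ?_
  have hprod : ∏ i ∈ Finset.univ.erase (0 : Fin (m + 1)), (n.1 i : ℝ) =
      ∏ i : Fin m, (n.1 i.succ : ℝ) := by
    rw [← Finset.compl_singleton, ← Fin.image_succ_univ,
      Finset.prod_image (Fin.succ_injective m).injOn]
  change (1 - z) ^ n.1 (0 : Fin (m + 1)) / ((n.1 (0 : Fin (m + 1)) : ℝ) ^ 2 *
    ∏ i ∈ Finset.univ.erase (0 : Fin (m + 1)), (n.1 i : ℝ)) = _
  rw [hprod, Finset.prod_inv_distrib, ← div_div, div_eq_mul_inv _ (∏ i : Fin m, _)]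
end

section
/- For every integer k ≥ 2 and every real λ < 0, ∫₀¹ Li_{2,1,…,1}(1−z) · z^{−λ−1} dz = (−1/λ) · ∑_{n₁>n₂>⋯>n_{k−1}>0} (1/(n₁² n₂ ⋯ n_{k−1})) · n₁! / ( (n₁−λ)(n₁−1−λ)⋯(1−λ) ), where the index of the multiple polylogarithm is (2,1,…,1) with k−2 ones. -/
open scoped BigOperators

open MeasureTheory

/-- A product of a summable nonnegative sequence with itself, `m` times, is summable over tuples. -/
theorem summable_fin_prod_of_nonneg {f : ℕ → ℝ} (hf : Summable f) (hf0 : 0 ≤ f) (m : ℕ) :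
    Summable fun n : Fin m → ℕ => ∏ i, f (n i) := by
  induction m with
  | zero => exact Summable.of_finite
  | succ m ih =>
    rw [← (Fin.consEquiv fun _ : Fin (m + 1) => ℕ).summable_iff]
    have h := hf.mul_of_nonneg ih hf0 fun n => Finset.prod_nonneg fun i _ => hf0 (n i)
    convert h using 2 with x
    simp [Fin.prod_univ_succ, Fin.consEquiv]

/-- The series defining the multiple zeta value `ζ(2, 1, …, 1)` converges. -/
theorem summable_multiple_zeta_two_one {m : ℕ} (j : Fin m) (hj : ∀ i, j ≤ i) :
    Summable fun n : {n : Fin m → ℕ // StrictAnti n ∧ ∀ i, 0 < n i} =>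
      1 / ((n.1 j : ℝ) ^ 2 * ∏ i ∈ Finset.univ.erase j, (n.1 i : ℝ)) := by
  have hm : (0 : ℝ) < m := by exact_mod_cast j.pos
  have hs : Summable fun n : ℕ => 1 / (n : ℝ) ^ (1 + 1 / (m : ℝ)) :=
    Real.summable_one_div_nat_rpow.2 (by simpa using hm)
  have hp := (summable_fin_prod_of_nonneg hs (fun n => by positivity) m).comp_injective
    (Subtype.val_injective (p := fun n : Fin m → ℕ => StrictAnti n ∧ ∀ i, 0 < n i))
  refine hp.of_nonneg_of_le (fun n => by positivity) fun n => ?_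
  have hpos : ∀ i, (0 : ℝ) < n.1 i := fun i => by exact_mod_cast n.2.2 i
  have hprod : (n.1 j : ℝ) ^ 2 * ∏ i ∈ Finset.univ.erase j, (n.1 i : ℝ)
      = (n.1 j : ℝ) * ∏ i, (n.1 i : ℝ) := by
    rw [← Finset.mul_prod_erase Finset.univ (fun i => (n.1 i : ℝ)) (Finset.mem_univ j)]
    ring
  have hroot : ∏ i, (n.1 i : ℝ) ^ (1 / (m : ℝ)) ≤ n.1 j := by
    calc ∏ i, (n.1 i : ℝ) ^ (1 / (m : ℝ)) ≤ ∏ _i : Fin m, (n.1 j : ℝ) ^ (1 / (m : ℝ)) := by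
          refine Finset.prod_le_prod (fun i _ => by positivity) fun i _ => ?_
          have : (n.1 i : ℝ) ≤ n.1 j := by exact_mod_cast n.2.1.antitone (hj i)
          gcongr
      _ = n.1 j := by
          rw [Finset.prod_const, Finset.card_univ, Fintype.card_fin, ← Real.rpow_natCast,
            ← Real.rpow_mul (hpos j).le, one_div_mul_cancel hm.ne', Real.rpow_one]
  simp only [Function.comp_apply, Finset.prod_div_distrib, Finset.prod_const_one]
  rw [hprod]
  refine one_div_le_one_div_of_le (Finset.prod_pos fun i _ => Real.rpow_pos_of_pos (hpos i) _) ?_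
  have hsplit : ∏ i, (n.1 i : ℝ) ^ (1 + 1 / (m : ℝ))
      = (∏ i, (n.1 i : ℝ) ^ (1 / (m : ℝ))) * ∏ i, (n.1 i : ℝ) := by
    rw [← Finset.prod_mul_distrib]
    refine Finset.prod_congr rfl fun i _ => ?_
    rw [Real.rpow_add (hpos i), Real.rpow_one, mul_comm]
  rw [hsplit]
  gcongr

theorem ofReal_one_sub_pow_mul_rpow (s : ℝ) (n : ℕ) {x : ℝ} (hx : 0 ≤ x) :
    (((1 - x) ^ n * x ^ (s - 1) : ℝ) : ℂ)
      = (x : ℂ) ^ ((s : ℂ) - 1) * (1 - (x : ℂ)) ^ (((n : ℂ) + 1) - 1) := by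
  rw [add_sub_cancel_right, Complex.cpow_natCast]
  push_cast [Complex.ofReal_cpow hx]
  ring

theorem integrableOn_one_sub_pow_mul_rpow {s : ℝ} (hs : 0 < s) (n : ℕ) :
    IntegrableOn (fun x : ℝ => (1 - x) ^ n * x ^ (s - 1)) (Set.Ioo 0 1) := by
  have h := Complex.betaIntegral_convergent (u := s) (v := (n : ℂ) + 1) (by simpa using hs)
    (by simp; positivity)
  rw [intervalIntegrable_iff_integrableOn_Ioo_of_le zero_le_one] at h
  refine (Integrable.re h).congr ?_
  filter_upwards [ae_restrict_mem measurableSet_Ioo] with x hx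
  rw [← ofReal_one_sub_pow_mul_rpow s n hx.1.le]
  exact Complex.ofReal_re _

/-- The beta integral with one integer parameter. -/
theorem integral_one_sub_pow_mul_rpow {s : ℝ} (hs : 0 < s) (n : ℕ) :
    ∫ x in Set.Ioo (0 : ℝ) 1, (1 - x) ^ n * x ^ (s - 1)
      = n.factorial / ∏ i ∈ Finset.range (n + 1), (s + i) := by
  have h := Complex.betaIntegral_eval_nat_add_one_right (u := s) (by simpa using hs) n
  rw [Complex.betaIntegral, intervalIntegral.integral_of_le zero_le_one,
    integral_Ioc_eq_integral_Ioo, setIntegral_congr_fun measurableSet_Ioo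
      fun x hx => (ofReal_one_sub_pow_mul_rpow s n hx.1.le).symm, integral_complex_ofReal] at h
  exact_mod_cast h

theorem factorial_le_prod_add_one_sub {a : ℝ} (ha : a ≤ 0) (n : ℕ) :
    (n.factorial : ℝ) ≤ ∏ i ∈ Finset.range n, ((i : ℝ) + 1 - a) := by
  rw [← Finset.prod_range_add_one_eq_factorial]
  push_cast
  exact Finset.prod_le_prod (fun i _ => by positivity) fun i _ => by linarith

theorem integral_one_sub_pow_mul_rpow_neg_sub_one {lam : ℝ} (hlam : lam < 0) (n : ℕ) :
    ∫ z in Set.Ioo (0 : ℝ) 1, (1 - z) ^ n * z ^ (-lam - 1)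
      = (-1 / lam) * (n.factorial / ∏ i ∈ Finset.range n, ((i : ℝ) + 1 - lam)) := by
  rw [integral_one_sub_pow_mul_rpow (neg_pos.2 hlam), Finset.prod_range_succ']
  have hterm : ∀ i : ℕ, -lam + ((i + 1 : ℕ) : ℝ) = (i : ℝ) + 1 - lam := fun i => by push_cast; ring
  simp only [hterm, Nat.cast_zero, add_zero]
  rw [div_mul_div_comm, mul_comm lam, mul_neg, neg_one_mul, neg_div, div_neg]

/-- Termwise Mellin transform of a nonnegative, absolutely convergent series in powers
of `1 - z`. -/
theorem integral_tsum_mul_one_sub_pow_mul_rpow {ι : Type*} [Countable ι] {c : ι → ℝ}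
    (hc0 : ∀ i, 0 ≤ c i) (hcs : Summable c) (N : ι → ℕ) {lam : ℝ} (hlam : lam < 0) :
    ∫ z in Set.Ioo (0 : ℝ) 1, (∑' i, c i * (1 - z) ^ N i) * z ^ (-lam - 1)
      = (-1 / lam) * ∑' i, c i *
        ((N i).factorial / ∏ j ∈ Finset.range (N i), ((j : ℝ) + 1 - lam)) := by
  have hprod : ∀ n : ℕ, 0 < ∏ j ∈ Finset.range n, ((j : ℝ) + 1 - lam) := fun n =>
    Finset.prod_pos fun j _ => by linarith [(j.cast_nonneg : (0 : ℝ) ≤ j)]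
  have hint : ∀ i, ∫ z in Set.Ioo (0 : ℝ) 1, c i * ((1 - z) ^ N i * z ^ (-lam - 1))
      = (-1 / lam) * (c i *
        ((N i).factorial / ∏ j ∈ Finset.range (N i), ((j : ℝ) + 1 - lam))) := fun i => by
    rw [integral_const_mul, integral_one_sub_pow_mul_rpow_neg_sub_one hlam, mul_left_comm]
  have hnorm : ∀ i, ∫ z in Set.Ioo (0 : ℝ) 1, ‖c i * ((1 - z) ^ N i * z ^ (-lam - 1))‖
      = ∫ z in Set.Ioo (0 : ℝ) 1, c i * ((1 - z) ^ N i * z ^ (-lam - 1)) := fun i => by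
    refine setIntegral_congr_fun measurableSet_Ioo fun z hz => Real.norm_of_nonneg ?_
    have h1 : 0 ≤ 1 - z := by linarith [hz.2]
    have h2 := hz.1.le
    exact mul_nonneg (hc0 i) (by positivity)
  have hsum : Summable fun i => ∫ z in Set.Ioo (0 : ℝ) 1,
      ‖c i * ((1 - z) ^ N i * z ^ (-lam - 1))‖ := by
    simp only [hnorm, hint]
    exact (hcs.of_nonneg_of_le
      (fun i => mul_nonneg (hc0 i) (div_nonneg (Nat.cast_nonneg _) (hprod _).le)) fun i =>
        mul_le_of_le_one_right (hc0 i)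
          ((div_le_one (hprod _)).2 (factorial_le_prod_add_one_sub hlam.le _))).mul_left _
  have hmain := (hasSum_integral_of_summable_integral_norm
    (fun i => (integrableOn_one_sub_pow_mul_rpow (neg_pos.2 hlam) (N i)).const_mul (c i))
    hsum).tsum_eq
  simp only [hint, tsum_mul_left] at hmain
  rw [hmain]
  simp only [← tsum_mul_right, mul_assoc]

/-- For `k ≥ 2` and `λ < 0`,
`∫₀¹ Li_{2,1,…,1}(1-z) · z^{-λ-1} dz
  = (-1/λ) · ∑_{n₁ > ⋯ > n_{k-1} > 0} (1/(n₁² n₂ ⋯ n_{k-1})) · n₁! / ((n₁-λ)(n₁-1-λ)⋯(1-λ))`,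
where the index of the multiple polylogarithm is `(2, 1, …, 1)` with `k - 2` ones, i.e.
`Li_{2,1,…,1}(1-z) = ∑_{n₁ > ⋯ > n_{k-1} > 0} (1-z)^{n₁} / (n₁² n₂ ⋯ n_{k-1})`. -/
theorem mellin_last_term (k : ℕ) (hk : 2 ≤ k) (lam : ℝ) (hlam : lam < 0) :
    (∫ z in Set.Ioo (0 : ℝ) 1,
        (∑' n : {n : Fin (k - 1) → ℕ // StrictAnti n ∧ ∀ i, 0 < n i},
          (1 - z) ^ (n.1 ⟨0, by omega⟩) /
            (((n.1 ⟨0, by omega⟩ : ℝ)) ^ 2 *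
              ∏ i ∈ Finset.univ.erase (⟨0, by omega⟩ : Fin (k - 1)), (n.1 i : ℝ)))
        * z ^ (-lam - 1))
      = (-1 / lam) *
        ∑' n : {n : Fin (k - 1) → ℕ // StrictAnti n ∧ ∀ i, 0 < n i},
          (1 / (((n.1 ⟨0, by omega⟩ : ℝ)) ^ 2 *
              ∏ i ∈ Finset.univ.erase (⟨0, by omega⟩ : Fin (k - 1)), (n.1 i : ℝ))) *
            (Nat.factorial (n.1 ⟨0, by omega⟩) : ℝ) /
              ∏ i ∈ Finset.range (n.1 ⟨0, by omega⟩), (((i : ℝ) + 1) - lam) := by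
  have hk1 : 0 < k - 1 := by omega
  have h := integral_tsum_mul_one_sub_pow_mul_rpow (fun n => by positivity)
    (summable_multiple_zeta_two_one (⟨0, hk1⟩ : Fin (k - 1)) fun i => Nat.zero_le i.1)
    (fun n => n.1 ⟨0, hk1⟩) hlam
  simp only [one_div_mul_eq_div] at h
  simp only [one_div_mul_eq_div, div_right_comm]
  exact h
end

section
/- Sum formula in depth 2: for every integer l ≥ 0, ζ(3+l) = ∑ ζ(2+c₁, 1+c₂), where the sum ranges over all pairs of integers c₁, c₂ ≥ 0 with c₁ + c₂ = l. -/
open scoped BigOperators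

/-- The double zeta value `ζ(a, b) = ∑_{n₁ > n₂ > 0} 1/(n₁^a n₂^b)`. -/
noncomputable def doubleZeta (a b : ℕ) : ℝ :=
  ∑' p : {p : ℕ × ℕ // 0 < p.2 ∧ p.2 < p.1},
    1 / ((p.1.1 : ℝ) ^ a * (p.1.2 : ℝ) ^ b)

/-- The pairs `n₁ > n₂ > 0`, parametrised as `(n₁, n₂) = (a + b + 2, a + 1)`. -/
def prodEquivDecreasingPairs : ℕ × ℕ ≃ {p : ℕ × ℕ // 0 < p.2 ∧ p.2 < p.1} where
  toFun p := ⟨(p.1 + p.2 + 2, p.1 + 1), by simp, by simp only; omega⟩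
  invFun q := (q.1.2 - 1, q.1.1 - q.1.2 - 1)
  left_inv p := by ext <;> simp; omega
  right_inv := by
    rintro ⟨⟨n, m⟩, h₁, h₂⟩
    simp only [Subtype.mk.injEq, Prod.mk.injEq] at *
    omega

theorem doubleZeta_eq_tsum_prod (s t : ℕ) :
    doubleZeta s t =
      ∑' p : ℕ × ℕ, 1 / (((p.1 : ℝ) + p.2 + 2) ^ s * ((p.1 : ℝ) + 1) ^ t) := by
  rw [doubleZeta, ← prodEquivDecreasingPairs.tsum_eq]
  simp [prodEquivDecreasingPairs]

theorem hasSum_one_div_sub_one_div_add (m : ℕ) :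
    HasSum (fun b : ℕ => 1 / ((b : ℝ) + 1) - 1 / ((b : ℝ) + 1 + m))
      (∑ i ∈ Finset.range m, 1 / ((i : ℝ) + 1)) := by
  induction m with
  | zero => simp
  | succ m ih =>
    have telescope : HasSum (fun b : ℕ => 1 / ((b : ℝ) + 1 + m) - 1 / ((b : ℝ) + 1 + m + 1))
        (1 / ((m : ℝ) + 1)) := by
      rw [hasSum_iff_tendsto_nat_of_nonneg]
      · have partial_sum (n : ℕ) : ∑ b ∈ Finset.range n,
            (1 / ((b : ℝ) + 1 + m) - 1 / ((b : ℝ) + 1 + m + 1)) =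
              1 / ((m : ℝ) + 1) - 1 / (((n + m : ℕ) : ℝ) + 1) := by
          have h := Finset.sum_range_sub' (fun b : ℕ => 1 / ((b : ℝ) + 1 + m)) n
          push_cast at h ⊢
          convert h using 3 <;> ring
        simp only [partial_sum]
        simpa using ((Filter.tendsto_add_atTop_iff_nat m).2
          (tendsto_one_div_add_atTop_nhds_zero_nat (𝕜 := ℝ))).const_sub (1 / ((m : ℝ) + 1))
      · intro b
        exact sub_nonneg.2 (one_div_le_one_div_of_le (by positivity) (by linarith))
    rw [Finset.sum_range_succ]
    convert ih.add telescope using 2 with b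
    push_cast
    ring

theorem hasSum_one_div_mul_add (m : ℕ) (hm : m ≠ 0) :
    HasSum (fun b : ℕ => 1 / (((b : ℝ) + 1) * ((b : ℝ) + 1 + m)))
      ((∑ i ∈ Finset.range m, 1 / ((i : ℝ) + 1)) / m) := by
  convert (hasSum_one_div_sub_one_div_add m).div_const (m : ℝ) using 1
  · rfl
  ext b
  have : (m : ℝ) ≠ 0 := by exact_mod_cast hm
  field_simp
  ring

theorem summable_one_div_mul_mul_add :
    Summable fun p : ℕ × ℕ =>
      1 / (((p.1 : ℝ) + 1) * ((p.2 : ℝ) + 1) * ((p.1 : ℝ) + p.2 + 2)) := by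
  have h : Summable fun n : ℕ => 1 / √((n : ℝ) + 1) ^ 3 := by
    have := (summable_nat_add_iff 1).2
      (Real.summable_one_div_nat_rpow (p := 3 / 2)|>.2 (by norm_num))
    refine this.congr fun n => ?_
    rw [Real.sqrt_eq_rpow, ← Real.rpow_natCast, ← Real.rpow_mul (by positivity)]
    norm_num
  refine (h.mul_of_nonneg h (fun _ => by positivity) (fun _ => by positivity)).of_nonneg_of_le
    (fun _ => by positivity) fun p => ?_
  rw [div_mul_div_comm, one_mul]
  have hx : 0 < √((p.1 : ℝ) + 1) := by positivity
  have hy : 0 < √((p.2 : ℝ) + 1) := by positivity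
  have hx2 := Real.sq_sqrt (show (0 : ℝ) ≤ p.1 + 1 by positivity)
  have hy2 := Real.sq_sqrt (show (0 : ℝ) ≤ p.2 + 1 by positivity)
  refine one_div_le_one_div_of_le (by positivity) ?_
  generalize √((p.1 : ℝ) + 1) = x at *
  generalize √((p.2 : ℝ) + 1) = y at *
  rw [show (p.1 : ℝ) + p.2 + 2 = x ^ 2 + y ^ 2 by linarith, ← hx2, ← hy2]
  have : x * y ≤ x ^ 2 + y ^ 2 := by nlinarith [sq_nonneg (x - y)]
  calc x ^ 3 * y ^ 3 = x ^ 2 * y ^ 2 * (x * y) := by ring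
    _ ≤ x ^ 2 * y ^ 2 * (x ^ 2 + y ^ 2) := by gcongr

theorem summable_one_div_pow_mul_mul_add (l : ℕ) :
    Summable fun p : ℕ × ℕ =>
      1 / (((p.1 : ℝ) + 1) ^ (l + 1) * (((p.2 : ℝ) + 1) * ((p.1 : ℝ) + p.2 + 2))) := by
  refine summable_one_div_mul_mul_add.of_nonneg_of_le (fun _ => by positivity) fun p => ?_
  rw [mul_assoc]
  gcongr
  exact le_self_pow₀ (by linarith [(p.1.cast_nonneg : (0 : ℝ) ≤ p.1)]) (by omega)

theorem summable_one_div_mul_add_pow (l : ℕ) :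
    Summable fun p : ℕ × ℕ =>
      1 / (((p.2 : ℝ) + 1) * ((p.1 : ℝ) + p.2 + 2) ^ (l + 2)) := by
  refine (summable_one_div_pow_mul_mul_add l).of_nonneg_of_le (fun _ => by positivity) fun p => ?_
  refine one_div_le_one_div_of_le (by positivity) ?_
  calc ((p.1 : ℝ) + 1) ^ (l + 1) * (((p.2 : ℝ) + 1) * ((p.1 : ℝ) + p.2 + 2))
      ≤ ((p.1 : ℝ) + p.2 + 2) ^ (l + 1) * (((p.2 : ℝ) + 1) * ((p.1 : ℝ) + p.2 + 2)) := by
        gcongr ?_ ^ _ * _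
        linarith [(p.2.cast_nonneg : (0 : ℝ) ≤ p.2)]
    _ = _ := by ring

theorem summable_doubleZeta_terms (c d : ℕ) :
    Summable fun p : ℕ × ℕ =>
      1 / (((p.1 : ℝ) + p.2 + 2) ^ (2 + c) * ((p.1 : ℝ) + 1) ^ (1 + d)) := by
  refine summable_one_div_mul_mul_add.of_nonneg_of_le (fun _ => by positivity) fun p => ?_
  refine one_div_le_one_div_of_le (by positivity) ?_
  have ha : (0 : ℝ) ≤ p.1 := p.1.cast_nonneg
  have hb : (0 : ℝ) ≤ p.2 := p.2.cast_nonneg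
  calc ((p.1 : ℝ) + 1) * ((p.2 : ℝ) + 1) * ((p.1 : ℝ) + p.2 + 2)
      ≤ ((p.1 : ℝ) + 1) * ((p.1 : ℝ) + p.2 + 2) * ((p.1 : ℝ) + p.2 + 2) := by
        gcongr _ * ?_ * _
        linarith
    _ = ((p.1 : ℝ) + p.2 + 2) ^ 2 * ((p.1 : ℝ) + 1) ^ 1 := by ring
    _ ≤ _ := by
        gcongr ?_ * ?_
        · exact pow_le_pow_right₀ (by linarith) (by omega)
        · exact pow_le_pow_right₀ (by linarith) (by omega)

theorem sum_antidiagonal_one_div_pow_mul_pow (l : ℕ) {m k : ℝ} (hm : 0 < m) (hk : 0 < k) :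
    ∑ c ∈ Finset.HasAntidiagonal.antidiagonal l, 1 / ((m + k) ^ (2 + c.1) * m ^ (1 + c.2)) =
      1 / (m ^ (l + 1) * (k * (m + k))) - 1 / (k * (m + k) ^ (l + 2)) := by
  have geom := geom_sum₂_mul (1 / (m + k)) (1 / m) (l + 1)
  rw [Nat.add_sub_cancel, ← Finset.Nat.sum_antidiagonal_eq_sum_range_succ
    (fun i j => (1 / (m + k)) ^ i * (1 / m) ^ j) l] at geom
  have factor : ∑ c ∈ Finset.HasAntidiagonal.antidiagonal l,
      1 / ((m + k) ^ (2 + c.1) * m ^ (1 + c.2)) =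
        1 / ((m + k) ^ 2 * m) * ∑ c ∈ Finset.HasAntidiagonal.antidiagonal l,
          (1 / (m + k)) ^ c.1 * (1 / m) ^ c.2 := by
    rw [Finset.mul_sum]
    refine Finset.sum_congr rfl fun c _ => ?_
    simp only [pow_add, one_div, inv_pow, mul_inv, pow_one]
    ring
  have hmk : m + k ≠ 0 := by positivity
  have hd : 1 / (m + k) - 1 / m = -(k / (m * (m + k))) := by
    field_simp
    ring
  have hd0 : -(k / (m * (m + k))) ≠ 0 := neg_ne_zero.2 (by positivity)
  rw [factor, eq_div_of_mul_eq (by rwa [hd]) geom, hd]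
  simp only [one_div, inv_pow]
  field_simp
  ring

theorem hasSum_harmonic_div_pow (l : ℕ) :
    HasSum (fun a : ℕ => (∑ i ∈ Finset.range (a + 1), 1 / ((i : ℝ) + 1)) / ((a : ℝ) + 1) ^ (l + 2))
      (∑' p : ℕ × ℕ,
        1 / (((p.1 : ℝ) + 1) ^ (l + 1) * (((p.2 : ℝ) + 1) * ((p.1 : ℝ) + p.2 + 2)))) := by
  refine (summable_one_div_pow_mul_mul_add l).hasSum.prod_fiberwise fun a => ?_
  convert (hasSum_one_div_mul_add (a + 1) (by omega)).div_const (((a : ℝ) + 1) ^ (l + 1)) using 1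
  · rfl
  · ext b
    push_cast
    field_simp
    ring
  · push_cast
    rw [div_div]
    ring

theorem hasSum_harmonic_pred_div_pow (l : ℕ) :
    HasSum (fun n : ℕ => (∑ i ∈ Finset.range n, 1 / ((i : ℝ) + 1)) / ((n : ℝ) + 1) ^ (l + 2))
      (∑' p : ℕ × ℕ, 1 / (((p.2 : ℝ) + 1) * ((p.1 : ℝ) + p.2 + 2) ^ (l + 2))) := by
  have h := (Finset.HasAntidiagonal.sigmaAntidiagonalEquivProd (A := ℕ)).hasSum_iff.2
    (summable_one_div_mul_add_pow l).hasSum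
  have h' := h.sigma fun n => (hasSum_fintype _)
  rw [← hasSum_nat_add_iff' 1]
  simp only [Finset.range_one, Finset.sum_singleton, Finset.range_zero, Finset.sum_empty,
    zero_div, sub_zero]
  convert h' using 2 with n
  · rfl
  simp only [Function.comp, Finset.HasAntidiagonal.sigmaAntidiagonalEquivProd_apply]
  rw [Finset.sum_coe_sort (Finset.HasAntidiagonal.antidiagonal n)
    (fun p : ℕ × ℕ => 1 / (((p.2 : ℝ) + 1) * ((p.1 : ℝ) + p.2 + 2) ^ (l + 2))),
    ← Finset.Nat.sum_antidiagonal_swap, Finset.sum_div,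
    ← Finset.Nat.sum_antidiagonal_eq_sum_range_succ
      (fun i _ => 1 / ((i : ℝ) + 1) / (((n + 1 : ℕ) : ℝ) + 1) ^ (l + 2)) n]
  refine Finset.sum_congr rfl fun p hp => ?_
  rw [Finset.HasAntidiagonal.mem_antidiagonal] at hp
  rw [← hp, div_div]
  simp only [Prod.fst_swap, Prod.snd_swap]
  push_cast
  ring

/-- Sum formula in depth 2: for every `l ≥ 0`,
`ζ(3+l) = ∑_{c₁+c₂=l, c₁,c₂ ≥ 0} ζ(2+c₁, 1+c₂)`. -/
theorem sum_formula_depth_two (l : ℕ) :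
    riemannZetaReal (3 + l)
      = ∑ c ∈ Finset.HasAntidiagonal.antidiagonal l, doubleZeta (2 + c.1) (1 + c.2) := by
  simp only [doubleZeta_eq_tsum_prod]
  rw [← Summable.tsum_finsetSum (f := fun (c p : ℕ × ℕ) =>
    1 / (((p.1 : ℝ) + p.2 + 2) ^ (2 + c.1) * ((p.1 : ℝ) + 1) ^ (1 + c.2))) fun c _ => summable_doubleZeta_terms c.1 c.2]
  have split_terms (p : ℕ × ℕ) : ∑ c ∈ Finset.HasAntidiagonal.antidiagonal l,
      1 / (((p.1 : ℝ) + p.2 + 2) ^ (2 + c.1) * ((p.1 : ℝ) + 1) ^ (1 + c.2)) =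
        1 / (((p.1 : ℝ) + 1) ^ (l + 1) * (((p.2 : ℝ) + 1) * ((p.1 : ℝ) + p.2 + 2))) -
          1 / (((p.2 : ℝ) + 1) * ((p.1 : ℝ) + p.2 + 2) ^ (l + 2)) := by
    have h := sum_antidiagonal_one_div_pow_mul_pow l (m := (p.1 : ℝ) + 1) (k := (p.2 : ℝ) + 1)
      (by positivity) (by positivity)
    rwa [show (p.1 : ℝ) + 1 + (p.2 + 1) = p.1 + p.2 + 2 by ring] at h
  simp only [split_terms]
  rw [(summable_one_div_pow_mul_mul_add l).tsum_sub (summable_one_div_mul_add_pow l),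
    riemannZetaReal]
  refine HasSum.tsum_eq ?_
  convert (hasSum_harmonic_div_pow l).sub (hasSum_harmonic_pred_div_pow l) using 2 with n
  · rfl
  rw [Finset.sum_range_succ, ← sub_div, add_sub_cancel_left, div_div]
  ring
end

section
/- Differential relations for multiple polylogarithms composed with the Landen substitution: let m ≥ 1 and let k₁,…,k_m be positive integers, and let z be a complex number with |z/(z−1)| < 1. If k₁ ≥ 2 then d/dz Li_{k₁,k₂,…,k_m}(z/(z−1)) = (1/(z(1−z))) · Li_{k₁−1,k₂,…,k_m}(z/(z−1)); if k₁ = 1 then d/dz Li_{k₁,k₂,…,k_m}(z/(z−1)) = −(1/(1−z)) · Li_{k₂,…,k_m}(z/(z−1)), where for m = 1 the empty multiple polylogarithm is interpreted as the constant function 1. -/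
open scoped BigOperators

/-- The (complex) multiple polylogarithm `Li_{k₁,…,k_m}(w) = ∑_{n₁ > ⋯ > n_m > 0}
w^{n₁} / (n₁^{k₁} ⋯ n_m^{k_m})`, indexed by a list `k = [k₁, …, k_m]`;
for the empty list it is the constant `1`. -/
noncomputable def MPLC (k : List ℕ) (w : ℂ) : ℂ :=
  ∑' n : {n : Fin k.length → ℕ // StrictAnti n ∧ ∀ i, 0 < n i},
    (if h : 0 < k.length then w ^ (n.1 ⟨0, h⟩) else 1) /
      ∏ i, ((n.1 i : ℂ)) ^ (k.get i)

/-- The index set of the multiple polylogarithm series of depth `m`: strictly decreasing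
`m`-tuples of positive integers. -/
abbrev MPLIndex (m : ℕ) : Type :=
  {n : Fin m → ℕ // StrictAnti n ∧ ∀ i, 0 < n i}

namespace MPLIndex

/-- The largest entry of a tuple, with value `0` for the empty tuple. -/
def top {m : ℕ} (n : MPLIndex m) : ℕ :=
  if h : 0 < m then n.1 ⟨0, h⟩ else 0

@[simp] lemma top_succ {m : ℕ} (n : MPLIndex (m + 1)) : n.top = n.1 0 := by
  simp [top]

lemma apply_le_top {m : ℕ} (n : MPLIndex m) (i : Fin m) : n.1 i ≤ n.top := by
  have hm : 0 < m := i.pos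
  rw [top, dif_pos hm]
  exact n.2.1.antitone (Fin.mk_le_of_le_val (Nat.zero_le _))

/-- Prepend to a tuple the entry exceeding its largest entry by `d + 1`. -/
def cons {m : ℕ} (t : MPLIndex m) (d : ℕ) : MPLIndex (m + 1) :=
  ⟨Fin.cons (t.top + d + 1) t.1, by
    constructor
    · intro i j hij
      induction j using Fin.cases with
      | zero => exact absurd hij (Fin.not_lt_zero i)
      | succ j =>
        induction i using Fin.cases with
        | zero =>
          have := t.apply_le_top j
          simp only [Fin.cons_zero, Fin.cons_succ]
          omega
        | succ i => simpa using t.2.1 (Fin.succ_lt_succ_iff.mp hij)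
    · intro i
      induction i using Fin.cases with
      | zero => simp
      | succ i => simpa using t.2.2 i⟩

/-- Remove the largest entry of a tuple. -/
def tail {m : ℕ} (n : MPLIndex (m + 1)) : MPLIndex m :=
  ⟨Fin.tail n.1, fun _ _ h => n.2.1 (Fin.succ_lt_succ_iff.mpr h), fun i => n.2.2 i.succ⟩

lemma top_tail_lt {m : ℕ} (n : MPLIndex (m + 1)) : n.tail.top < n.1 0 := by
  cases m with
  | zero => simpa [top] using n.2.2 0
  | succ m => exact (top_succ n.tail).trans_lt (n.2.1 (Fin.succ_pos 0))

/-- A nonempty tuple is the same as its tail together with the gap between the two largest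
entries. -/
def consEquiv (m : ℕ) : MPLIndex m × ℕ ≃ MPLIndex (m + 1) where
  toFun p := p.1.cons p.2
  invFun n := (n.tail, n.1 0 - n.tail.top - 1)
  left_inv p := by
    have h : (p.1.cons p.2).tail = p.1 := rfl
    ext1
    · exact h
    · simp only [h]
      simp only [cons, Fin.cons_zero]
      omega
  right_inv n := by
    have h := n.top_tail_lt
    apply Subtype.ext
    have h' : n.tail.top + (n.1 0 - n.tail.top - 1) + 1 = n.1 0 := by omega
    simp only [cons, h']
    exact Fin.cons_self_tail n.1

lemma consEquiv_apply_zero {m : ℕ} (p : MPLIndex m × ℕ) :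
    (consEquiv m p).1 0 = p.1.top + p.2 + 1 := rfl

lemma consEquiv_apply_succ {m : ℕ} (p : MPLIndex m × ℕ) (i : Fin m) :
    (consEquiv m p).1 i.succ = p.1.1 i := rfl

lemma summable_pow_top {r : ℝ} (h0 : 0 ≤ r) (h1 : r < 1) (m : ℕ) :
    Summable fun n : MPLIndex m => r ^ n.top := by
  induction m with
  | zero => exact Summable.of_finite
  | succ m ih =>
    rw [← (consEquiv m).summable_iff]
    refine ((ih.mul_of_nonneg (summable_geometric_of_lt_one h0 h1)
      (fun _ => pow_nonneg h0 _) (fun _ => pow_nonneg h0 _)).mul_right r).congr fun p => ?_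
    simp only [Function.comp_apply, top_succ, consEquiv_apply_zero, pow_add, pow_one]

lemma summable_pow_pred {r : ℝ} (h0 : 0 ≤ r) (h1 : r < 1) (m : ℕ) :
    Summable fun n : MPLIndex (m + 1) => r ^ (n.1 0 - 1) := by
  rw [← (consEquiv m).summable_iff]
  refine ((summable_pow_top h0 h1 m).mul_of_nonneg (summable_geometric_of_lt_one h0 h1)
    (fun _ => pow_nonneg h0 _) (fun _ => pow_nonneg h0 _)).congr fun p => ?_
  simp only [Function.comp_apply, consEquiv_apply_zero, Nat.add_sub_cancel, pow_add]

instance (m : ℕ) : Nonempty (MPLIndex m) := by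
  induction m with
  | zero => exact ⟨⟨Fin.elim0, fun i => i.elim0, fun i => i.elim0⟩⟩
  | succ m ih => exact ih.map fun t => t.cons 0

/-- The denominator `n₁^{k₁} ⋯ n_m^{k_m}` of a term of the multiple polylogarithm. -/
noncomputable def denom (k : List ℕ) (n : MPLIndex k.length) : ℂ :=
  ∏ i, ((n.1 i : ℂ)) ^ (k.get i)

lemma one_le_norm_denom (k : List ℕ) (n : MPLIndex k.length) : 1 ≤ ‖denom k n‖ := by
  rw [denom, norm_prod]
  refine Finset.one_le_prod fun i _ => ?_
  rw [norm_pow, Complex.norm_natCast]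
  exact one_le_pow₀ (Nat.one_le_cast.mpr (n.2.2 i))

lemma denom_cons (a : ℕ) (ks : List ℕ) (n : MPLIndex (ks.length + 1)) :
    denom (a :: ks) n = (n.1 0 : ℂ) ^ a * denom ks n.tail :=
  Fin.prod_univ_succ _

lemma natCast_div_denom_cons_succ (a : ℕ) (ks : List ℕ) (n : MPLIndex (ks.length + 1)) :
    (n.1 0 : ℂ) / denom ((a + 1) :: ks) n = 1 / denom (a :: ks) n := by
  have h : (n.1 0 : ℂ) ≠ 0 := by exact_mod_cast (n.2.2 0).ne'
  rw [denom_cons, denom_cons, pow_succ', mul_assoc, ← div_div, div_self h]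

end MPLIndex

open MPLIndex

lemma MPLC_eq_tsum (k : List ℕ) (w : ℂ) :
    MPLC k w = ∑' n : MPLIndex k.length, w ^ n.top / denom k n := by
  refine tsum_congr fun n => ?_
  unfold top denom
  split_ifs <;> simp

lemma norm_pow_div_denom_le (k : List ℕ) (n : MPLIndex k.length) (w : ℂ) (N : ℕ) :
    ‖w ^ N / denom k n‖ ≤ ‖w‖ ^ N := by
  rw [norm_div, norm_pow]
  exact div_le_self (by positivity) (one_le_norm_denom k n)

lemma summable_MPLC (k : List ℕ) {w : ℂ} (hw : ‖w‖ < 1) :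
    Summable fun n : MPLIndex k.length => w ^ n.top / denom k n :=
  .of_norm_bounded (summable_pow_top (norm_nonneg w) hw _)
    fun n => norm_pow_div_denom_le k n w _

/-- Termwise differentiation of the multiple polylogarithm series. -/
lemma hasDerivAt_MPLC_cons_succ (a : ℕ) (ks : List ℕ) {w : ℂ} (hw : ‖w‖ < 1) :
    HasDerivAt (MPLC ((a + 1) :: ks))
      (∑' n : MPLIndex (ks.length + 1), w ^ (n.1 0 - 1) / denom (a :: ks) n) w := by
  obtain ⟨r, hwr, hr1⟩ := exists_between hw
  have hr0 : 0 ≤ r := (norm_nonneg w).trans hwr.le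
  have hfun : MPLC ((a + 1) :: ks) = fun w => ∑' n : MPLIndex (ks.length + 1),
      w ^ n.1 0 / denom ((a + 1) :: ks) n := by
    funext w
    rw [MPLC_eq_tsum]
    exact tsum_congr fun n => by rw [top_succ]
  rw [hfun]
  refine hasDerivAt_tsum_of_isPreconnected (t := Metric.ball (0 : ℂ) r) (y₀ := w)
    (g := fun (n : MPLIndex (ks.length + 1)) y => y ^ n.1 0 / denom ((a + 1) :: ks) n)
    (g' := fun (n : MPLIndex (ks.length + 1)) y => y ^ (n.1 0 - 1) / denom (a :: ks) n)
    (summable_pow_pred hr0 hr1 ks.length)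
    Metric.isOpen_ball (convex_ball _ _).isPreconnected ?_ ?_ (by simpa using hwr) ?_
    (by simpa using hwr)
  · intro n y _
    refine ((hasDerivAt_pow (n.1 0) y).div_const (denom ((a + 1) :: ks) n)).congr_deriv ?_
    rw [mul_comm, mul_div_assoc, natCast_div_denom_cons_succ, mul_one_div]
  · intro n y hy
    have hy' : ‖y‖ < r := by simpa using hy
    exact (norm_pow_div_denom_le (a :: ks) n y _).trans
      (pow_le_pow_left₀ (norm_nonneg y) hy'.le _)
  · refine (summable_MPLC ((a + 1) :: ks) hw).congr fun n => ?_
    rw [top_succ]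

lemma mul_tsum_pow_pred (a : ℕ) (ks : List ℕ) (w : ℂ) :
    w * ∑' n : MPLIndex (ks.length + 1), w ^ (n.1 0 - 1) / denom (a :: ks) n =
      MPLC (a :: ks) w := by
  rw [MPLC_eq_tsum, ← tsum_mul_left]
  refine tsum_congr fun n => ?_
  rw [top_succ, ← mul_div_assoc, mul_pow_sub_one (n.2.2 0).ne']

lemma tsum_pow_pred_zero (ks : List ℕ) {w : ℂ} (hw : ‖w‖ < 1) :
    ∑' n : MPLIndex (ks.length + 1), w ^ (n.1 0 - 1) / denom (0 :: ks) n =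
      MPLC ks w * (1 - w)⁻¹ := by
  rw [MPLC_eq_tsum, ← tsum_geometric_of_norm_lt_one hw,
    tsum_mul_tsum_of_summable_norm (summable_MPLC ks hw).norm
      (summable_norm_geometric_of_norm_lt_one hw), ← (consEquiv ks.length).tsum_eq]
  refine tsum_congr fun p => ?_
  have h : (consEquiv ks.length p).tail = p.1 := rfl
  rw [denom_cons, h, consEquiv_apply_zero, Nat.add_sub_cancel, pow_zero, one_mul, pow_add,
    mul_div_right_comm]

lemma hasDerivAt_landen {z : ℂ} (hz : z ≠ 1) :
    HasDerivAt (fun w : ℂ => w / (w - 1)) (-1 / (z - 1) ^ 2) z := by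
  have h : z - 1 ≠ 0 := sub_ne_zero.mpr hz
  refine ((hasDerivAt_id' z).fun_div ((hasDerivAt_id' z).sub_const 1) h).congr_deriv ?_
  ring

/-- The multiple polylogarithm series diverges outside the closed unit disc, where its `tsum`
therefore takes the value `0`. -/
lemma MPLC_cons_eq_zero_of_one_lt_norm (a : ℕ) (ks : List ℕ) {w : ℂ} (hw : 1 < ‖w‖) :
    MPLC (a :: ks) w = 0 := by
  rw [MPLC_eq_tsum]
  refine tsum_eq_zero_of_not_summable fun hs => ?_
  obtain ⟨t⟩ : Nonempty (MPLIndex ks.length) := inferInstance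
  have hinj : Function.Injective fun d : ℕ => consEquiv ks.length (t, d) :=
    (consEquiv ks.length).injective.comp (Prod.mk_right_injective t)
  have hterm := (hs.comp_injective hinj).tendsto_atTop_zero.norm
  have hratio := (tendsto_pow_const_div_const_pow_of_one_lt a hw).comp
    (Filter.tendsto_add_atTop_nat (t.top + 1))
  have hD : ‖denom ks t‖ ≠ 0 := (one_pos.trans_le (one_le_norm_denom ks t)).ne'
  have hlim := hterm.mul hratio
  rw [norm_zero, zero_mul] at hlim
  refine inv_ne_zero hD (tendsto_nhds_unique (tendsto_const_nhds.congr fun d => ?_) hlim)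
  have hN : d + (t.top + 1) = t.top + d + 1 := by omega
  have htop : (consEquiv ks.length (t, d)).top = t.top + d + 1 := rfl
  have htail : (consEquiv ks.length (t, d)).tail = t := rfl
  have hN0 : ((t.top + d + 1 : ℕ) : ℝ) ≠ 0 := Nat.cast_ne_zero.mpr (Nat.succ_ne_zero _)
  have hw0 : ‖w‖ ≠ 0 := (one_pos.trans hw).ne'
  simp only [Function.comp_apply, hN]
  erw [denom_cons, htop]
  rw [htail, consEquiv_apply_zero, norm_div, norm_mul, norm_pow, norm_pow,
    Complex.norm_natCast]
  field_simp

lemma MPLC_cons_zero (a : ℕ) (ks : List ℕ) : MPLC (a :: ks) 0 = 0 := by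
  rw [← mul_tsum_pow_pred, zero_mul]

lemma MPLC_cons_landen_eventuallyEq_zero (a : ℕ) (ks : List ℕ) :
    (fun w : ℂ => MPLC (a :: ks) (w / (w - 1))) =ᶠ[nhds 1] fun _ => 0 := by
  filter_upwards [Metric.ball_mem_nhds (1 : ℂ) (half_pos one_pos)] with w hw
  rcases eq_or_ne w 1 with rfl | hw1
  · rw [sub_self, div_zero, MPLC_cons_zero]
  · refine MPLC_cons_eq_zero_of_one_lt_norm a ks ?_
    rw [mem_ball_iff_norm] at hw
    have h : ‖(1 : ℂ)‖ - ‖w‖ ≤ ‖w - 1‖ := norm_sub_rev w 1 ▸ norm_sub_norm_le 1 w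
    rw [norm_one] at h
    rw [norm_div, one_lt_div (norm_pos_iff.mpr (sub_ne_zero.mpr hw1))]
    linarith

/-- Differential relations for multiple polylogarithms composed with the Landen
substitution `z ↦ z/(z-1)`: for positive integers `k₁, …, k_m` (`m ≥ 1`, written as
`k₁ :: ks`) and `|z/(z-1)| < 1`:
if `k₁ ≥ 2` (and `z ≠ 0`) then
`d/dz Li_{k₁,…,k_m}(z/(z-1)) = (1/(z(1-z))) Li_{k₁-1,k₂,…,k_m}(z/(z-1))`;
if `k₁ = 1` then
`d/dz Li_{k₁,…,k_m}(z/(z-1)) = -(1/(1-z)) Li_{k₂,…,k_m}(z/(z-1))`,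
the empty multiple polylogarithm (case `m = 1`) being the constant `1`. -/
theorem deriv_MPL_landen (k₁ : ℕ) (ks : List ℕ) (hk₁ : 0 < k₁)
    (hks : ∀ a ∈ ks, 0 < a) (z : ℂ) (hz : ‖z / (z - 1)‖ < 1) :
    (2 ≤ k₁ → z ≠ 0 →
      HasDerivAt (fun w : ℂ => MPLC (k₁ :: ks) (w / (w - 1)))
        ((1 / (z * (1 - z))) * MPLC ((k₁ - 1) :: ks) (z / (z - 1))) z) ∧
    (k₁ = 1 →
      HasDerivAt (fun w : ℂ => MPLC (k₁ :: ks) (w / (w - 1)))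
        (-(1 / (1 - z)) * MPLC ks (z / (z - 1))) z) := by
  rcases eq_or_ne z 1 with rfl | h1
  · have h : HasDerivAt (fun w : ℂ => MPLC (k₁ :: ks) (w / (w - 1))) 0 1 :=
      (hasDerivAt_const (1 : ℂ) (0 : ℂ)).congr_of_eventuallyEq
        (MPLC_cons_landen_eventuallyEq_zero k₁ ks)
    exact ⟨fun _ _ => by simpa using h, fun _ => by simpa using h⟩
  obtain ⟨a, rfl⟩ : ∃ a, k₁ = a + 1 := ⟨k₁ - 1, by omega⟩
  have hsub : z - 1 ≠ 0 := sub_ne_zero.mpr h1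
  have hsub' : 1 - z ≠ 0 := sub_ne_zero.mpr h1.symm
  have hcomp := (hasDerivAt_MPLC_cons_succ a ks hz).comp z (hasDerivAt_landen h1)
  constructor
  · intro _ hz0
    refine hcomp.congr_deriv ?_
    rw [Nat.add_sub_cancel, ← mul_tsum_pow_pred, ← mul_assoc, mul_comm]
    congr 1
    rw [← neg_sub z 1]
    field_simp
  · intro ha
    obtain rfl : a = 0 := by omega
    refine hcomp.congr_deriv ?_
    have hinv : (1 - z / (z - 1))⁻¹ = 1 - z := by
      rw [inv_eq_iff_eq_inv, ← neg_sub z 1]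
      field_simp
      ring
    rw [tsum_pow_pred_zero ks hz, hinv, ← neg_sub z 1]
    field_simp
end
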